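/- arXiv:1402.0462 — 9 statements merged into one kernel-verified Lean document; each statement's English description precedes it below -/
import Mathlib

section
/- Let f be a circuit polynomial with circuit number Θ_f. Then f(x) ≥ 0 for all x ∈ ℝⁿ if and only if either (i) y ∉ (2ℕ)ⁿ and |c| ≤ Θ_f, or (ii) y ∈ (2ℕ)ⁿ and c ≥ −Θ_f. -/
/-- The monomial with exponent a convex combination of exponents is the corresponding weighted
geometric mean of the monomials. -/
theorem prod_pow_eq_prod_rpow_of_barycentric {ι κ : Type*} [Fintype ι] [Fintype κ]
    {α : κ → ι → ℕ} {y : ι → ℕ} {lam : κ → ℝ} (hlam : ∀ j, 0 ≤ lam j)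
    (hy : ∀ i, (y i : ℝ) = ∑ j, lam j * (α j i : ℝ)) {t : ι → ℝ} (ht : ∀ i, 0 ≤ t i) :
    ∏ i, t i ^ y i = ∏ j, (∏ i, t i ^ α j i) ^ lam j := by
  have hpow (i : ι) : t i ^ y i = ∏ j, (t i ^ α j i) ^ lam j := by
    rw [← Real.rpow_natCast, hy,
      Real.rpow_sum_of_nonneg (ht i) fun j _ => mul_nonneg (hlam j) (Nat.cast_nonneg _)]
    refine Finset.prod_congr rfl fun j _ => ?_
    rw [mul_comm, Real.rpow_mul (ht i), Real.rpow_natCast]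
  simp_rw [hpow]
  rw [Finset.prod_comm]
  exact Finset.prod_congr rfl fun j _ =>
    Real.finsetProd_rpow _ _ (fun i _ => pow_nonneg (ht i) _) _

/-- The circuit number times the inner monomial is a weighted geometric mean of the terms at the
vertices. -/
theorem circuitNumber_mul_prod_pow {ι κ : Type*} [Fintype ι] [Fintype κ]
    {α : κ → ι → ℕ} {y : ι → ℕ} {lam b : κ → ℝ} (hlam : ∀ j, 0 < lam j) (hb : ∀ j, 0 < b j)
    (hy : ∀ i, (y i : ℝ) = ∑ j, lam j * (α j i : ℝ)) {t : ι → ℝ} (ht : ∀ i, 0 ≤ t i) :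
    (∏ j, (b j / lam j) ^ lam j) * ∏ i, t i ^ y i =
      ∏ j, (b j / lam j * ∏ i, t i ^ α j i) ^ lam j := by
  rw [prod_pow_eq_prod_rpow_of_barycentric (fun j => (hlam j).le) hy ht,
    ← Finset.prod_mul_distrib]
  exact Finset.prod_congr rfl fun j _ =>
    (Real.mul_rpow (div_pos (hb j) (hlam j)).le
      (Finset.prod_nonneg fun i _ => pow_nonneg (ht i) _)).symm

theorem circuitNumber_mul_prod_pow_le {ι κ : Type*} [Fintype ι] [Fintype κ]
    {α : κ → ι → ℕ} {y : ι → ℕ} {lam b : κ → ℝ} (hlam : ∀ j, 0 < lam j)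
    (hlamsum : ∑ j, lam j = 1) (hb : ∀ j, 0 < b j)
    (hy : ∀ i, (y i : ℝ) = ∑ j, lam j * (α j i : ℝ)) {t : ι → ℝ} (ht : ∀ i, 0 ≤ t i) :
    (∏ j, (b j / lam j) ^ lam j) * ∏ i, t i ^ y i ≤ ∑ j, b j * ∏ i, t i ^ α j i := by
  rw [circuitNumber_mul_prod_pow hlam hb hy ht]
  refine (Real.geom_mean_le_arith_mean_weighted _ _ _ (fun j _ => (hlam j).le) hlamsum
    fun j _ => mul_nonneg (div_pos (hb j) (hlam j)).le
      (Finset.prod_nonneg fun i _ => pow_nonneg (ht i) _)).trans_eq ?_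
  refine Finset.sum_congr rfl fun j _ => ?_
  rw [← mul_assoc, mul_div_cancel₀ _ (hlam j).ne']

/-- An affine function can be prescribed at the vertices of a full-dimensional simplex. -/
theorem AffineIndependent.exists_dotProduct_add_eq {n : ℕ} {p : Fin (n + 1) → Fin n → ℝ}
    (hp : AffineIndependent ℝ p) (v : Fin (n + 1) → ℝ) :
    ∃ (u : Fin n → ℝ) (s : ℝ), ∀ j, ∑ i, u i * p j i + s = v j := by
  have hspan : affineSpan ℝ (Set.range p) = ⊤ :=
    hp.affineSpan_eq_top_iff_card_eq_finrank_add_one.2 (by simp)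
  let B : AffineBasis (Fin (n + 1)) ℝ (Fin n → ℝ) := ⟨p, hp, hspan⟩
  let g : (Fin n → ℝ) →ᵃ[ℝ] ℝ := (Fintype.linearCombination ℝ v).toAffineMap.comp B.coords
  have hg (j : Fin (n + 1)) : g (p j) = v j := by
    have hB (k : Fin (n + 1)) : B.coord k (p j) = if k = j then 1 else 0 := B.coord_apply k j
    simp [g, Fintype.linearCombination_apply, hB]
  refine ⟨fun i => g.linear (Pi.single i 1), g 0, fun j => ?_⟩
  have hlin : ∑ i, g.linear (Pi.single i 1) * p j i = g.linear (p j) := by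
    rw [LinearMap.pi_apply_eq_sum_univ g.linear (p j)]
    refine Finset.sum_congr rfl fun i _ => ?_
    rw [smul_eq_mul, mul_comm]
    congr 2
    ext k
    simp [Pi.single_apply, eq_comm]
  rw [hlin, ← hg j, congrFun g.decomp (p j), Pi.add_apply]

/-- Equality in the weighted arithmetic-geometric mean inequality is attained at a positive
point. -/
theorem exists_pos_circuitNumber_mul_prod_pow_eq {n : ℕ} {α : Fin (n + 1) → Fin n → ℕ}
    (haff : AffineIndependent ℝ (fun j : Fin (n + 1) => (fun i : Fin n => (α j i : ℝ))))
    {y : Fin n → ℕ} {lam b : Fin (n + 1) → ℝ} (hlam : ∀ j, 0 < lam j)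
    (hlamsum : ∑ j, lam j = 1) (hb : ∀ j, 0 < b j)
    (hy : ∀ i, (y i : ℝ) = ∑ j, lam j * (α j i : ℝ)) :
    ∃ t : Fin n → ℝ, (∀ i, 0 < t i) ∧
      ∑ j, b j * ∏ i, t i ^ α j i = (∏ j, (b j / lam j) ^ lam j) * ∏ i, t i ^ y i := by
  obtain ⟨u, s, hus⟩ := haff.exists_dotProduct_add_eq fun j => Real.log (lam j / b j)
  refine ⟨fun i => Real.exp (u i), fun i => Real.exp_pos _, ?_⟩
  have hmon (j : Fin (n + 1)) :
      ∏ i, Real.exp (u i) ^ α j i = lam j / b j * Real.exp (-s) := by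
    rw [← Real.exp_log (div_pos (hlam j) (hb j)), ← hus, ← Real.exp_add, add_neg_cancel_right,
      Real.exp_sum]
    exact Finset.prod_congr rfl fun i _ => by rw [← Real.exp_nat_mul, mul_comm]
  have hterm (j : Fin (n + 1)) :
      b j / lam j * ∏ i, Real.exp (u i) ^ α j i = Real.exp (-s) := by
    have := (hlam j).ne'
    have := (hb j).ne'
    rw [hmon]
    field_simp
  rw [circuitNumber_mul_prod_pow hlam hb hy fun i => (Real.exp_pos _).le]
  simp_rw [hterm]
  rw [← Real.rpow_sum_of_pos (Real.exp_pos _), hlamsum, Real.rpow_one]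
  have hsum (j : Fin (n + 1)) :
      b j * ∏ i, Real.exp (u i) ^ α j i = lam j * Real.exp (-s) := by
    rw [← hterm j, ← mul_assoc, mul_div_cancel₀ _ (hlam j).ne']
  simp_rw [hsum]
  rw [← Finset.sum_mul, hlamsum, one_mul]


/-- A circuit polynomial `f(x) = Σ_{j=0}^{n} b_j x^{α(j)} + c x^{y}` is
nonnegative on ℝⁿ iff either `y ∉ (2ℕ)ⁿ` and `|c| ≤ Θ_f`, or `y ∈ (2ℕ)ⁿ` and `c ≥ -Θ_f`,
where `Θ_f = ∏_j (b_j/λ_j)^{λ_j}` is the circuit number. -/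
theorem circuit_poly_nonneg_iff
    (n : ℕ) (hn : 1 ≤ n)
    (α : Fin (n + 1) → Fin n → ℕ)
    (hαeven : ∀ j i, Even (α j i))
    (haff : AffineIndependent ℝ (fun j : Fin (n + 1) => (fun i : Fin n => (α j i : ℝ))))
    (b : Fin (n + 1) → ℝ) (hb : ∀ j, 0 < b j)
    (c : ℝ) (hc : c ≠ 0)
    (y : Fin n → ℕ)
    (lam : Fin (n + 1) → ℝ) (hlam : ∀ j, 0 < lam j)
    (hlamsum : ∑ j, lam j = 1)
    (hy : ∀ i, (y i : ℝ) = ∑ j, lam j * (α j i : ℝ)) :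
    (∀ x : Fin n → ℝ,
        0 ≤ ∑ j, b j * ∏ i, x i ^ α j i + c * ∏ i, x i ^ y i) ↔
      ((¬ ∀ i, Even (y i)) ∧ |c| ≤ ∏ j, (b j / lam j) ^ (lam j)) ∨
      ((∀ i, Even (y i)) ∧ -(∏ j, (b j / lam j) ^ (lam j)) ≤ c) := by
  have hTheta : 0 ≤ ∏ j, (b j / lam j) ^ lam j :=
    Finset.prod_nonneg fun j _ => Real.rpow_nonneg (div_pos (hb j) (hlam j)).le _
  constructor
  · intro hf
    obtain ⟨t, ht, heq⟩ := exists_pos_circuitNumber_mul_prod_pow_eq haff hlam hlamsum hb hy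
    have hty : 0 < ∏ i, t i ^ y i := Finset.prod_pos fun i _ => pow_pos (ht i) _
    have hlow : -(∏ j, (b j / lam j) ^ lam j) ≤ c := by
      have h := hf t
      rw [heq, ← add_mul] at h
      linarith [nonneg_of_mul_nonneg_left h hty]
    by_cases hyeven : ∀ i, Even (y i)
    · exact Or.inr ⟨hyeven, hlow⟩
    · refine Or.inl ⟨hyeven, abs_le.2 ⟨hlow, ?_⟩⟩
      obtain ⟨k, hk⟩ := not_forall.1 hyeven
      have hflip (i : Fin n) : Function.update t k (-t k) i ^ y i
          = (if i = k then -1 else 1) * t i ^ y i := by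
        rcases eq_or_ne i k with rfl | hik
        · simp [(Nat.not_even_iff_odd.1 hk).neg_pow]
        · simp [hik]
      have hvertex (j : Fin (n + 1)) (i : Fin n) :
          Function.update t k (-t k) i ^ α j i = t i ^ α j i := by
        rcases eq_or_ne i k with rfl | hik
        · simp [(hαeven j i).neg_pow]
        · simp [hik]
      have h := hf (Function.update t k (-t k))
      simp_rw [hvertex, hflip, Finset.prod_mul_distrib] at h
      simp only [Finset.prod_ite_eq', Finset.mem_univ, if_true] at h
      rw [heq, neg_one_mul, mul_neg, ← sub_eq_add_neg, ← sub_mul] at h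
      linarith [nonneg_of_mul_nonneg_left h hty]
  · intro h x
    have hamgm := circuitNumber_mul_prod_pow_le hlam hlamsum hb hy (t := fun i => |x i|)
      fun i => abs_nonneg _
    simp_rw [(hαeven _ _).pow_abs] at hamgm
    have habs : |∏ i, x i ^ y i| = ∏ i, |x i| ^ y i := by
      simp_rw [Finset.abs_prod, abs_pow]
    rw [← habs] at hamgm
    suffices -((∏ j, (b j / lam j) ^ lam j) * |∏ i, x i ^ y i|) ≤ c * ∏ i, x i ^ y i by linarith
    rcases h with ⟨-, hcle⟩ | ⟨hyeven, hcle⟩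
    · calc -((∏ j, (b j / lam j) ^ lam j) * |∏ i, x i ^ y i|)
          ≤ -(|c| * |∏ i, x i ^ y i|) := by gcongr
        _ = -|c * ∏ i, x i ^ y i| := by rw [abs_mul]
        _ ≤ c * ∏ i, x i ^ y i := neg_abs_le _
    · rw [abs_of_nonneg (Finset.prod_nonneg fun i _ => (hyeven i).pow_nonneg _), ← neg_mul]
      exact mul_le_mul_of_nonneg_right hcle
        (Finset.prod_nonneg fun i _ => (hyeven i).pow_nonneg _)
end

section
/- Let f be a circuit polynomial with α(0) = 0 and b_0 = λ_0, and suppose either (y ∉ (2ℕ)ⁿ and |c| = Θ_f) or (y ∈ (2ℕ)ⁿ and c = −Θ_f). Let s* ∈ ℝⁿ be the vector satisfying ⟨s*, α(j)⟩ = log(λ_j/b_j) for all j = 1,…,n. Then every zero v ∈ ℝⁿ of f satisfies |v_j| = exp(s*_j) for all j = 1,…,n; in particular the set {v ∈ ℝⁿ : f(v) = 0} has at most 2ⁿ elements. -/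
/-- A linear functional that vanishes on `n + 1` affinely independent points of `ℝⁿ` is zero. -/
theorem eq_zero_of_affineIndependent {n : ℕ} {p : Fin (n + 1) → Fin n → ℝ}
    (hp : AffineIndependent ℝ p) (φ : (Fin n → ℝ) →ₗ[ℝ] ℝ) (h : ∀ j, φ (p j) = 0) : φ = 0 := by
  have htop : vectorSpan ℝ (Set.range p) = ⊤ :=
    hp.vectorSpan_eq_top_of_card_eq_finrank_add_one (by simp)
  have hle : vectorSpan ℝ (Set.range p) ≤ LinearMap.ker φ := by
    rw [vectorSpan_def, Submodule.span_le]
    rintro _ ⟨_, ⟨j, rfl⟩, _, ⟨k, rfl⟩, rfl⟩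
    simp [h]
  rw [htop, top_le_iff] at hle
  exact LinearMap.ker_eq_top.mp hle

/-- A monomial in nonnegative variables whose exponent is a convex combination of exponents `α j`
is the weighted geometric mean of the monomials with these exponents. -/
theorem prod_pow_eq_prod_rpow {ι κ : Type*} [Fintype ι] [Fintype κ] {α : κ → ι → ℕ} {y : ι → ℕ}
    {w : κ → ℝ} (hw : ∀ j, 0 ≤ w j) (hy : ∀ i, (y i : ℝ) = ∑ j, w j * (α j i : ℝ))
    {u : ι → ℝ} (hu : ∀ i, 0 ≤ u i) :
    ∏ i, u i ^ y i = ∏ j, (∏ i, u i ^ α j i) ^ w j := by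
  have hprod (j : κ) : (∏ i, u i ^ α j i) ^ w j = ∏ i, u i ^ (w j * (α j i : ℝ)) := by
    rw [← Real.finsetProd_rpow _ _ fun i _ => pow_nonneg (hu i) _]
    refine Finset.prod_congr rfl fun i _ => ?_
    rw [mul_comm, Real.rpow_mul (hu i), Real.rpow_natCast]
  simp_rw [hprod]
  rw [Finset.prod_comm]
  refine Finset.prod_congr rfl fun i _ => ?_
  rw [← Real.rpow_sum_of_nonneg (hu i) fun j _ => mul_nonneg (hw j) (Nat.cast_nonneg _),
    ← hy, Real.rpow_natCast]

/-- Equality in the weighted AM-GM inequality forces all terms to agree. -/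
theorem eq_of_sum_le_prod_rpow {κ : Type*} [Fintype κ] {w z : κ → ℝ} (hw : ∀ j, 0 < w j)
    (hw1 : ∑ j, w j = 1) (hz : ∀ j, 0 ≤ z j) (h : ∑ j, w j * z j ≤ ∏ j, z j ^ w j) (j k : κ) :
    z j = z k := by
  have heq : ∏ j, z j ^ w j = ∑ j, w j * z j :=
    le_antisymm (Real.geom_mean_le_arith_mean_weighted _ _ _ (fun j _ => (hw j).le) hw1
      fun j _ => hz j) h
  exact (Real.geom_mean_eq_arith_mean_weighted_iff_of_pos Finset.univ w z (fun j _ => hw j) hw1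
    fun j _ => hz j).mp heq j (Finset.mem_univ _) k (Finset.mem_univ _)

/-- At most `2ⁿ` vectors have prescribed absolute values of their coordinates. -/
theorem finite_and_ncard_le_of_abs_eq {n : ℕ} {S : Set (Fin n → ℝ)} {r : Fin n → ℝ}
    (h : ∀ v ∈ S, ∀ i, |v i| = r i) : S.Finite ∧ S.ncard ≤ 2 ^ n := by
  classical
  have hsub : S ⊆ (Fintype.piFinset fun i => ({r i, -r i} : Finset ℝ) : Finset (Fin n → ℝ)) := by
    intro v hv
    simp only [Finset.mem_coe, Fintype.mem_piFinset, Finset.mem_insert, Finset.mem_singleton]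
    exact fun i => eq_or_eq_neg_of_abs_eq (h v hv i)
  refine ⟨(Finset.finite_toSet _).subset hsub, (Set.ncard_le_ncard hsub).trans ?_⟩
  rw [Set.ncard_coe_finset, Fintype.card_piFinset]
  exact (Finset.prod_le_pow_card _ _ 2 fun i _ => Finset.card_le_two).trans (by simp)


/-- For a circuit polynomial with `α(0) = 0`, `b_0 = λ_0`, lying on the
boundary (`|c| = Θ_f` if `y ∉ (2ℕ)ⁿ`, resp. `c = -Θ_f` if `y ∈ (2ℕ)ⁿ`), every real zero `v`
satisfies `|v_i| = exp(s*_i)` where `⟨s*, α(j)⟩ = log(λ_j/b_j)`; in particular there are at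
most `2ⁿ` real zeros. -/
theorem circuit_poly_boundary_zeros
    (n : ℕ) (hn : 1 ≤ n)
    (α : Fin (n + 1) → Fin n → ℕ)
    (hαeven : ∀ j i, Even (α j i))
    (hα0 : ∀ i, α 0 i = 0)
    (haff : AffineIndependent ℝ (fun j : Fin (n + 1) => (fun i : Fin n => (α j i : ℝ))))
    (b : Fin (n + 1) → ℝ) (hb : ∀ j, 0 < b j)
    (c : ℝ) (hc : c ≠ 0)
    (y : Fin n → ℕ)
    (lam : Fin (n + 1) → ℝ) (hlam : ∀ j, 0 < lam j)
    (hlamsum : ∑ j, lam j = 1)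
    (hy : ∀ i, (y i : ℝ) = ∑ j, lam j * (α j i : ℝ))
    (hb0 : b 0 = lam 0)
    (hboundary :
      ((¬ ∀ i, Even (y i)) ∧ |c| = ∏ j, (b j / lam j) ^ (lam j)) ∨
      ((∀ i, Even (y i)) ∧ c = -(∏ j, (b j / lam j) ^ (lam j))))
    (s : Fin n → ℝ)
    (hs : ∀ j : Fin (n + 1), j ≠ 0 →
      ∑ i, s i * (α j i : ℝ) = Real.log (lam j / b j)) :
    (∀ v : Fin n → ℝ,
        (∑ j, b j * ∏ i, v i ^ α j i + c * ∏ i, v i ^ y i = 0) →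
        ∀ i, |v i| = Real.exp (s i)) ∧
    {v : Fin n → ℝ |
        ∑ j, b j * ∏ i, v i ^ α j i + c * ∏ i, v i ^ y i = 0}.Finite ∧
    Set.ncard {v : Fin n → ℝ |
        ∑ j, b j * ∏ i, v i ^ α j i + c * ∏ i, v i ^ y i = 0} ≤ 2 ^ n := by
  have hmain : ∀ v : Fin n → ℝ, (∑ j, b j * ∏ i, v i ^ α j i + c * ∏ i, v i ^ y i = 0) →
      ∀ i, |v i| = Real.exp (s i) := by
    intro v hv
    have habs (j : Fin (n + 1)) : ∏ i, v i ^ α j i = ∏ i, |v i| ^ α j i :=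
      Finset.prod_congr rfl fun i _ => ((hαeven j i).pow_abs _).symm
    have hM (j : Fin (n + 1)) : 0 ≤ ∏ i, |v i| ^ α j i :=
      Finset.prod_nonneg fun i _ => pow_nonneg (abs_nonneg _) _
    have hq (j : Fin (n + 1)) : 0 < b j / lam j := div_pos (hb j) (hlam j)
    have hc_abs : |c| = ∏ j, (b j / lam j) ^ lam j := by
      rcases hboundary with ⟨_, h⟩ | ⟨_, h⟩
      · exact h
      · rw [h, abs_neg, abs_of_pos (Finset.prod_pos fun j _ => Real.rpow_pos_of_pos (hq j) _)]
    have hle : ∑ j, lam j * (b j / lam j * ∏ i, |v i| ^ α j i) ≤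
        ∏ j, (b j / lam j * ∏ i, |v i| ^ α j i) ^ lam j := by
      calc ∑ j, lam j * (b j / lam j * ∏ i, |v i| ^ α j i)
          = ∑ j, b j * ∏ i, v i ^ α j i := by
            refine Finset.sum_congr rfl fun j _ => ?_
            rw [habs, ← mul_assoc, mul_div_cancel₀ _ (hlam j).ne']
        _ = -(c * ∏ i, v i ^ y i) := eq_neg_of_add_eq_zero_left hv
        _ ≤ |c * ∏ i, v i ^ y i| := neg_le_abs _
        _ = |c| * ∏ i, |v i| ^ y i := by simp only [abs_mul, Finset.abs_prod, abs_pow]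
        _ = ∏ j, (b j / lam j * ∏ i, |v i| ^ α j i) ^ lam j := by
            rw [hc_abs, prod_pow_eq_prod_rpow (fun j => (hlam j).le) hy fun i => abs_nonneg (v i),
              ← Finset.prod_mul_distrib]
            exact Finset.prod_congr rfl fun j _ => (Real.mul_rpow (hq j).le (hM j)).symm
    have hmon (j : Fin (n + 1)) : ∏ i, |v i| ^ α j i = lam j / b j := by
      have h := eq_of_sum_le_prod_rpow hlam hlamsum
        (fun j => mul_nonneg (hq j).le (hM j)) hle j 0
      simp only [hα0, hb0, pow_zero, Finset.prod_const_one, mul_one, div_self (hlam 0).ne'] at h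
      rw [← inv_div, eq_inv_of_mul_eq_one_right h]
    have hv0 (i : Fin n) : v i ≠ 0 := by
      intro hvi
      have hproj : (LinearMap.proj i : (Fin n → ℝ) →ₗ[ℝ] ℝ) = 0 := by
        refine eq_zero_of_affineIndependent haff _ fun j => ?_
        by_contra hne
        have hzero : ∏ i, |v i| ^ α j i = 0 :=
          Finset.prod_eq_zero (Finset.mem_univ i) (by
            rw [hvi, abs_zero, zero_pow]
            simpa using hne)
        exact (div_pos (hlam j) (hb j)).ne' ((hmon j).symm.trans hzero)
      simpa using LinearMap.congr_fun hproj 1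
    have hlog (j : Fin (n + 1)) : ∑ i, (α j i : ℝ) * Real.log |v i| = Real.log (lam j / b j) := by
      rw [← hmon j, Real.log_prod fun i _ => pow_ne_zero _ (abs_ne_zero.mpr (hv0 i))]
      simp only [Real.log_pow]
    have hfun : Fintype.linearCombination ℝ (fun i => Real.log |v i| - s i) = 0 := by
      refine eq_zero_of_affineIndependent haff _ fun j => ?_
      rw [Fintype.linearCombination_apply]
      rcases eq_or_ne j 0 with rfl | hj
      · simp [hα0]
      · simp only [smul_eq_mul, mul_sub, Finset.sum_sub_distrib]
        rw [hlog j, ← hs j hj, sub_eq_zero]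
        exact Finset.sum_congr rfl fun i _ => mul_comm _ _
    intro i
    have hi := LinearMap.congr_fun hfun (Pi.single i 1)
    rw [Fintype.linearCombination_apply_single, one_smul, LinearMap.zero_apply, sub_eq_zero] at hi
    rw [← hi, Real.exp_log (abs_pos.mpr (hv0 i))]
  exact ⟨hmain, finite_and_ncard_le_of_abs_eq hmain⟩
end

section
/- Let f be a circuit polynomial with α(0) = 0, b_0 = λ_0 and c < 0. Then the smooth function F : ℝⁿ → ℝ defined by F(w) = f(e^{w_1},…,e^{w_n}) has exactly one critical point (a unique point where the gradient of F vanishes), and F attains its global minimum over ℝⁿ at this point. -/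
/-- The function `u ↦ a + ∑ βₖ exp(uₖ) + c exp(∑ μₖ uₖ)`, which is the exponential form of a circuit
polynomial in the coordinates given by its nonzero vertices. -/
noncomputable def expCircuit {ι : Type*} [Fintype ι] (a c : ℝ) (β μ u : ι → ℝ) : ℝ :=
  a + ∑ k, β k * Real.exp (u k) + c * Real.exp (∑ k, μ k * u k)

section expCircuit

variable {ι : Type*} [Fintype ι] {a c : ℝ} {β μ : ι → ℝ}

theorem hasFDerivAt_expCircuit (u : ι → ℝ) :
    HasFDerivAt (expCircuit a c β μ)
      (∑ k, (β k * Real.exp (u k) + c * μ k * Real.exp (∑ l, μ l * u l)) •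
        ContinuousLinearMap.proj (R := ℝ) (φ := fun _ : ι => ℝ) k) u := by
  have hproj (k : ι) : HasFDerivAt (fun u : ι → ℝ => u k)
      (ContinuousLinearMap.proj (R := ℝ) (φ := fun _ : ι => ℝ) k) u :=
    hasFDerivAt_apply k u
  have h1 : HasFDerivAt (fun u : ι → ℝ => ∑ k, β k * Real.exp (u k))
      (∑ k, β k • Real.exp (u k) • ContinuousLinearMap.proj (R := ℝ) (φ := fun _ : ι => ℝ) k) u :=
    HasFDerivAt.fun_sum fun k _ => ((hproj k).exp.const_mul (β k))
  have h2 : HasFDerivAt (fun u : ι → ℝ => ∑ k, μ k * u k)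
      (∑ k, μ k • ContinuousLinearMap.proj (R := ℝ) (φ := fun _ : ι => ℝ) k) u :=
    HasFDerivAt.fun_sum fun k _ => ((hproj k).const_mul (μ k))
  refine ((h1.const_add a).add (h2.exp.const_mul c)).congr_fderiv ?_
  ext v
  simp only [add_apply, sum_apply,
    smul_apply, ContinuousLinearMap.proj_apply, smul_eq_mul, Finset.mul_sum,
    ← Finset.sum_add_distrib]
  exact Finset.sum_congr rfl fun k _ => by ring

theorem fderiv_expCircuit_eq_zero_iff {u : ι → ℝ} :
    fderiv ℝ (expCircuit a c β μ) u = 0 ↔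
      ∀ k, β k * Real.exp (u k) = -c * μ k * Real.exp (∑ l, μ l * u l) := by
  classical
  rw [(hasFDerivAt_expCircuit u).fderiv]
  constructor
  · intro h k
    have hk := congrArg (fun T : (ι → ℝ) →L[ℝ] ℝ => T (Pi.single k 1)) h
    simp [Pi.single_apply] at hk
    linarith
  · intro h
    refine Finset.sum_eq_zero fun k _ => ?_
    rw [h k, show -c * μ k * Real.exp (∑ l, μ l * u l) + c * μ k * Real.exp (∑ l, μ l * u l) = 0 by
      ring, zero_smul]

theorem exists_fderiv_expCircuit_eq_zero (hβ : ∀ k, 0 < β k) (hc : c < 0) (hμ : ∀ k, 0 < μ k)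
    (hsum : ∑ k, μ k < 1) : ∃ u, fderiv ℝ (expCircuit a c β μ) u = 0 := by
  set r : ι → ℝ := fun k => Real.log (-c * μ k / β k) with hr
  set s : ℝ := (∑ k, μ k * r k) / (1 - ∑ k, μ k) with hs
  have hs' : ∑ k, μ k * (r k + s) = s := by
    have : 1 - ∑ k, μ k ≠ 0 := by linarith
    simp only [mul_add, Finset.sum_add_distrib, ← Finset.sum_mul]
    rw [eq_div_iff this] at hs
    linarith
  refine ⟨fun k => r k + s, fderiv_expCircuit_eq_zero_iff.2 fun k => ?_⟩
  have hpos : 0 < -c * μ k / β k := div_pos (mul_pos (neg_pos.2 hc) (hμ k)) (hβ k)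
  have hβk := (hβ k).ne'
  rw [hs', Real.exp_add, hr, Real.exp_log hpos]
  field_simp

theorem eq_of_fderiv_expCircuit_eq_zero (hβ : ∀ k, 0 < β k) (hsum : ∑ k, μ k < 1) {u v : ι → ℝ}
    (hu : fderiv ℝ (expCircuit a c β μ) u = 0) (hv : fderiv ℝ (expCircuit a c β μ) v = 0) :
    u = v := by
  rw [fderiv_expCircuit_eq_zero_iff] at hu hv
  set s := ∑ l, μ l * u l with hs
  set t := ∑ l, μ l * v l with ht
  have key (k : ι) : u k - v k = s - t := by
    have h : Real.exp (u k + t) = Real.exp (v k + s) := by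
      refine mul_left_cancel₀ (hβ k).ne' ?_
      rw [Real.exp_add, Real.exp_add, ← mul_assoc, ← mul_assoc, hu k, hv k]
      ring
    linarith [Real.exp_injective h]
  have hd : s - t = (∑ k, μ k) * (s - t) := by
    rw [Finset.sum_mul]
    conv_lhs => rw [hs, ht, ← Finset.sum_sub_distrib]
    exact Finset.sum_congr rfl fun k _ => by rw [← key k]; ring
  have hst : s - t = 0 := by
    have : (1 - ∑ k, μ k) * (s - t) = 0 := by linarith
    exact (mul_eq_zero.1 this).resolve_left (by linarith)
  funext k
  linarith [key k]

theorem exp_sum_mul_le (hμ : ∀ k, 0 ≤ μ k) (hsum : ∑ k, μ k ≤ 1) (v : ι → ℝ) :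
    Real.exp (∑ k, μ k * v k) ≤ (1 - ∑ k, μ k) + ∑ k, μ k * Real.exp (v k) := by
  have h := convexOn_exp.map_sum_le (t := Finset.univ)
    (w := fun o : Option ι => o.elim (1 - ∑ k, μ k) μ) (p := fun o => o.elim 0 v)
    (by rintro (_ | k) - <;> simp [hμ, hsum]) (by simp [Fintype.sum_option]) (by simp)
  simpa [Fintype.sum_option] using h

theorem expCircuit_le_of_fderiv_eq_zero (hc : c < 0) (hμ : ∀ k, 0 < μ k)
    (hsum : ∑ k, μ k < 1) {u : ι → ℝ} (hu : fderiv ℝ (expCircuit a c β μ) u = 0) (v : ι → ℝ) :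
    expCircuit a c β μ u ≤ expCircuit a c β μ v := by
  rw [fderiv_expCircuit_eq_zero_iff] at hu
  set s := ∑ l, μ l * u l with hs
  have hJ := exp_sum_mul_le (fun k => (hμ k).le) hsum.le fun k => v k - u k
  have hE : 0 < -c * Real.exp s := mul_pos (neg_pos.2 hc) (Real.exp_pos s)
  have h1 : ∑ k, β k * Real.exp (u k) = -c * Real.exp s * ∑ k, μ k := by
    rw [Finset.mul_sum]
    exact Finset.sum_congr rfl fun k _ => by rw [hu k]; ring
  have h2 : ∑ k, β k * Real.exp (v k) =
      -c * Real.exp s * ∑ k, μ k * Real.exp (v k - u k) := by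
    rw [Finset.mul_sum]
    refine Finset.sum_congr rfl fun k _ => ?_
    rw [show v k = u k + (v k - u k) by ring, Real.exp_add, ← mul_assoc, hu k,
      add_sub_cancel_left]
    ring
  have h3 : Real.exp (∑ k, μ k * v k) = Real.exp s * Real.exp (∑ k, μ k * (v k - u k)) := by
    rw [← Real.exp_add, hs, ← Finset.sum_add_distrib]
    exact congrArg _ (Finset.sum_congr rfl fun k _ => by ring)
  simp only [expCircuit]
  rw [h1, h2, h3, ← hs]
  have := mul_le_mul_of_nonneg_left hJ hE.le
  linarith

end expCircuit

theorem AffineIndependent.isUnit_matrix_of_zero {K : Type*} [Field K] {n : ℕ}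
    {p : Fin (n + 1) → Fin n → K} (hp : AffineIndependent K p) (h0 : p 0 = 0) :
    IsUnit (Matrix.of fun k : Fin n => p k.succ) := by
  rw [← Matrix.linearIndependent_rows_iff_isUnit]
  rw [affineIndependent_iff_linearIndependent_vsub K p 0] at hp
  have := hp.comp (fun k : Fin n => (⟨k.succ, Fin.succ_ne_zero k⟩ : {x : Fin (n + 1) // x ≠ 0}))
    fun k l h => Fin.succ_injective _ (congrArg Subtype.val h)
  simp only [Function.comp_def, h0, vsub_eq_sub, sub_zero] at this
  exact this

theorem Real.prod_exp_pow {ι : Type*} [Fintype ι] (w : ι → ℝ) (m : ι → ℕ) :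
    ∏ i, Real.exp (w i) ^ m i = Real.exp (∑ i, (m i : ℝ) * w i) := by
  rw [Real.exp_sum]
  exact Finset.prod_congr rfl fun i _ => (Real.exp_nat_mul _ _).symm

/-- For a circuit polynomial with `α(0) = 0`, `b_0 = λ_0` and `c < 0`, the
function `F(w) = f(e^{w_1},…,e^{w_n})` has exactly one critical point, which is its global
minimizer. -/
theorem circuit_poly_exp_unique_critical_point
    (n : ℕ) (hn : 1 ≤ n)
    (α : Fin (n + 1) → Fin n → ℕ)
    (hαeven : ∀ j i, Even (α j i))
    (hα0 : ∀ i, α 0 i = 0)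
    (haff : AffineIndependent ℝ (fun j : Fin (n + 1) => (fun i : Fin n => (α j i : ℝ))))
    (b : Fin (n + 1) → ℝ) (hb : ∀ j, 0 < b j)
    (c : ℝ) (hc : c < 0)
    (y : Fin n → ℕ)
    (lam : Fin (n + 1) → ℝ) (hlam : ∀ j, 0 < lam j)
    (hlamsum : ∑ j, lam j = 1)
    (hy : ∀ i, (y i : ℝ) = ∑ j, lam j * (α j i : ℝ))
    (hb0 : b 0 = lam 0)
    (F : (Fin n → ℝ) → ℝ)
    (hF : ∀ w, F w = ∑ j, b j * ∏ i, Real.exp (w i) ^ α j i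
        + c * ∏ i, Real.exp (w i) ^ y i) :
    ∃ w₀ : Fin n → ℝ,
      fderiv ℝ F w₀ = 0 ∧
      (∀ w : Fin n → ℝ, fderiv ℝ F w = 0 → w = w₀) ∧
      (∀ w : Fin n → ℝ, F w₀ ≤ F w) := by
  let A : Matrix (Fin n) (Fin n) ℝ := Matrix.of fun k i => (α k.succ i : ℝ)
  have hA : IsUnit A := haff.isUnit_matrix_of_zero (by funext i; simp [hα0])
  let Φ : (Fin n → ℝ) ≃L[ℝ] (Fin n → ℝ) := (LinearEquiv.ofBijective A.mulVecLin
    ⟨Matrix.mulVec_injective_iff_isUnit.2 hA,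
      Matrix.mulVec_surjective_iff_isUnit.2 hA⟩).toContinuousLinearEquiv
  have hΦ (w : Fin n → ℝ) (k : Fin n) : Φ w k = ∑ i, (α k.succ i : ℝ) * w i := rfl
  let μ : Fin n → ℝ := fun k => lam k.succ
  let β : Fin n → ℝ := fun k => b k.succ
  have hμ (k : Fin n) : 0 < μ k := hlam _
  have hβ (k : Fin n) : 0 < β k := hb _
  have hsum : ∑ k, μ k < 1 := by
    rw [Fin.sum_univ_succ] at hlamsum
    linarith [hlam 0]
  have hyw (w : Fin n → ℝ) : ∑ i, (y i : ℝ) * w i = ∑ k, μ k * Φ w k := by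
    simp only [hΦ, hy, Fin.sum_univ_succ, hα0, Nat.cast_zero, mul_zero, zero_add, Finset.sum_mul,
      Finset.mul_sum]
    rw [Finset.sum_comm]
    exact Finset.sum_congr rfl fun k _ => Finset.sum_congr rfl fun i _ => mul_assoc _ _ _
  have hFG : F = expCircuit (b 0) c β μ ∘ Φ := by
    funext w
    simp only [hF, Real.prod_exp_pow, Fin.sum_univ_succ (n := n), hα0, hyw, Function.comp_apply,
      expCircuit, ← hΦ]
    simp [β]
  have hcrit (w : Fin n → ℝ) : fderiv ℝ F w = 0 ↔ fderiv ℝ (expCircuit (b 0) c β μ) (Φ w) = 0 := by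
    rw [hFG, Φ.comp_right_fderiv]
    refine ⟨fun h => ?_, fun h => by rw [h, ContinuousLinearMap.zero_comp]⟩
    ext1 u
    simpa using congrArg (fun T : (Fin n → ℝ) →L[ℝ] ℝ => T (Φ.symm u)) h
  obtain ⟨u, hu⟩ := exists_fderiv_expCircuit_eq_zero (a := b 0) hβ hc hμ hsum
  have hu' : fderiv ℝ (expCircuit (b 0) c β μ) (Φ (Φ.symm u)) = 0 := by
    rwa [Φ.apply_symm_apply]
  refine ⟨Φ.symm u, (hcrit _).2 hu', fun w hw => ?_, fun w => ?_⟩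
  · exact Φ.injective (eq_of_fderiv_expCircuit_eq_zero hβ hsum ((hcrit w).1 hw) hu')
  · rw [hFG]
    exact expCircuit_le_of_fderiv_eq_zero hc hμ hsum hu' (Φ w)
end

section
/- Let f be a circuit polynomial with α(0) = 0, b_0 = λ_0 and c = −Θ_f, and let s* ∈ ℝⁿ be the vector satisfying ⟨s*, α(j)⟩ = log(λ_j/b_j) for all j = 1,…,n. Then the function F(w) = f(e^{w_1},…,e^{w_n}) satisfies F(s*) = 0 and F(w) > 0 for every w ≠ s*; that is, s* is a zero of F and its unique global minimizer. -/
/-- In `ℝⁿ`, a vector orthogonal to all points of an affinely independent family of `n + 1` points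
that contains the origin is zero. -/
lemma eq_zero_of_dotProduct_affineIndependent_eq_zero {n : ℕ} {p : Fin (n + 1) → Fin n → ℝ}
    (hp : AffineIndependent ℝ p) (hp0 : p 0 = 0) {v : Fin n → ℝ}
    (hv : ∀ j, v ⬝ᵥ p j = 0) : v = 0 := by
  have hli := (affineIndependent_iff_linearIndependent_vsub ℝ p 0).1 hp
  have hspan := hli.span_eq_top_of_card_eq_finrank' (by simp)
  have hker : (⊤ : Submodule ℝ (Fin n → ℝ)) ≤ LinearMap.ker (dotProductBilin ℝ ℝ v) := by
    rw [← hspan, Submodule.span_le]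
    rintro _ ⟨j, rfl⟩
    simp [hp0, hv]
  have hvv : v ⬝ᵥ v = 0 := by simpa using hker (Submodule.mem_top (x := v))
  exact dotProduct_self_eq_zero.1 hvv

/-- A monomial evaluated at `e^w` is the exponential of a linear form. -/
lemma prod_exp_pow_eq_exp_sum {ι : Type*} [Fintype ι] (w : ι → ℝ) (a : ι → ℕ) :
    ∏ i, Real.exp (w i) ^ a i = Real.exp (∑ i, w i * (a i : ℝ)) := by
  rw [Real.exp_sum]
  exact Finset.prod_congr rfl fun i _ => by rw [← Real.exp_nat_mul, mul_comm]

/-- For a circuit polynomial with `α(0) = 0`, `b_0 = λ_0` and `c = -Θ_f`,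
the point `s*` with `⟨s*, α(j)⟩ = log(λ_j/b_j)` is a zero of `F(w) = f(e^w)` and its unique
global minimizer: `F(s*) = 0` and `F(w) > 0` for all `w ≠ s*`. -/
theorem circuit_poly_exp_zero_at_minimizer
    (n : ℕ) (hn : 1 ≤ n)
    (α : Fin (n + 1) → Fin n → ℕ)
    (hαeven : ∀ j i, Even (α j i))
    (hα0 : ∀ i, α 0 i = 0)
    (haff : AffineIndependent ℝ (fun j : Fin (n + 1) => (fun i : Fin n => (α j i : ℝ))))
    (b : Fin (n + 1) → ℝ) (hb : ∀ j, 0 < b j)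
    (y : Fin n → ℕ)
    (lam : Fin (n + 1) → ℝ) (hlam : ∀ j, 0 < lam j)
    (hlamsum : ∑ j, lam j = 1)
    (hy : ∀ i, (y i : ℝ) = ∑ j, lam j * (α j i : ℝ))
    (hb0 : b 0 = lam 0)
    (c : ℝ) (hc : c = -(∏ j, (b j / lam j) ^ (lam j)))
    (s : Fin n → ℝ)
    (hs : ∀ j : Fin (n + 1), j ≠ 0 →
      ∑ i, s i * (α j i : ℝ) = Real.log (lam j / b j))
    (F : (Fin n → ℝ) → ℝ)
    (hF : ∀ w, F w = ∑ j, b j * ∏ i, Real.exp (w i) ^ α j i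
        + c * ∏ i, Real.exp (w i) ^ y i) :
    F s = 0 ∧ ∀ w : Fin n → ℝ, w ≠ s → 0 < F w := by
  set p : (Fin n → ℝ) → Fin (n + 1) → ℝ :=
    fun w j => Real.log (b j / lam j) + ∑ i, w i * (α j i : ℝ) with hp
  have hq : ∀ j, 0 < b j / lam j := fun j => div_pos (hb j) (hlam j)
  have hFp : ∀ w, F w = ∑ j, lam j * Real.exp (p w j) - Real.exp (∑ j, lam j * p w j) := by
    intro w
    have hvertex : ∀ j, b j * ∏ i, Real.exp (w i) ^ α j i = lam j * Real.exp (p w j) := by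
      intro j
      rw [prod_exp_pow_eq_exp_sum, hp, Real.exp_add, Real.exp_log (hq j), ← mul_assoc,
        mul_div_cancel₀ _ (hlam j).ne']
    have hcircuit : ∏ j, (b j / lam j) ^ lam j
        = Real.exp (∑ j, lam j * Real.log (b j / lam j)) := by
      rw [Real.exp_sum]
      exact Finset.prod_congr rfl fun j _ => by rw [Real.rpow_def_of_pos (hq j), mul_comm]
    have hinner : ∑ i, w i * (y i : ℝ) = ∑ j, lam j * ∑ i, w i * (α j i : ℝ) := by
      simp only [hy, Finset.mul_sum]
      rw [Finset.sum_comm]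
      exact Finset.sum_congr rfl fun j _ => Finset.sum_congr rfl fun i _ => by ring
    rw [hF, hc, prod_exp_pow_eq_exp_sum w y, hcircuit, hinner, neg_mul, ← Real.exp_add,
      ← Finset.sum_add_distrib, ← sub_eq_add_neg]
    simp only [hvertex, hp, mul_add]
  have hp0 : ∀ w, p w 0 = 0 := fun w => by simp [hp, hα0, hb0, (hlam 0).ne']
  have hps : ∀ j, p s j = 0 := by
    intro j
    rcases eq_or_ne j 0 with rfl | hj
    · exact hp0 s
    · simp only [hp]
      rw [hs j hj, ← inv_div (b j), Real.log_inv, add_neg_cancel]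
  refine ⟨by simp [hFp, hps, hlamsum], fun w hw => ?_⟩
  rw [hFp, sub_pos]
  refine (strictConvexOn_exp.map_sum_lt_iff_of_pos (fun j _ => hlam j) hlamsum
    (fun j _ => Set.mem_univ (p w j))).2 ?_
  by_contra! hconst
  refine hw (sub_eq_zero.1 (eq_zero_of_dotProduct_affineIndependent_eq_zero haff
    (funext fun i => by simp [hα0]) fun j => ?_))
  have hj : p w j = p s j := by
    rw [hconst j (Finset.mem_univ j) 0 (Finset.mem_univ 0), hp0, hps]
  rw [sub_dotProduct, sub_eq_zero]
  exact add_left_cancel hj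
end

section
/- Let f be a circuit polynomial with α(0) = 0. Then f is nonnegative on ℝⁿ and has at least one real zero if and only if c = −Θ_f, or (c = Θ_f and y ∉ (2ℕ)ⁿ). (This characterizes membership of f in the topological boundary of the cone of nonnegative polynomials supported on the circuit, equivalently the vanishing of the A-discriminant at f.) -/
/-- A linearly independent family admits a linear functional with prescribed values. -/
theorem LinearIndependent.exists_linearMap_eq {K V ι : Type*} [Field K] [AddCommGroup V]
    [Module K V] {v : ι → V} (hv : LinearIndependent K v) (w : ι → K) :
    ∃ f : V →ₗ[K] K, ∀ i, f (v i) = w i := by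
  obtain ⟨f, hf⟩ := LinearMap.exists_extend ((Module.Basis.span hv).constr K w)
  refine ⟨f, fun i => ?_⟩
  have h := LinearMap.congr_fun hf (Module.Basis.span hv i)
  rw [Module.Basis.constr_basis, LinearMap.comp_apply, Submodule.subtype_apply,
    Module.Basis.span_apply] at h
  exact h

/-- An affinely independent family admits an affine functional with prescribed values. -/
theorem AffineIndependent.exists_sum_mul_add_eq {ι κ : Type*} [Fintype κ] {p : ι → κ → ℝ}
    (hp : AffineIndependent ℝ p) (j₀ : ι) (w : ι → ℝ) :
    ∃ (u : κ → ℝ) (k : ℝ), ∀ j, ∑ i, u i * p j i + k = w j := by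
  classical
  rw [affineIndependent_iff_linearIndependent_vsub ℝ p j₀] at hp
  obtain ⟨f, hf⟩ := hp.exists_linearMap_eq fun j => w j - w j₀
  have hsum (v : κ → ℝ) : ∑ i, f (Pi.single i 1) * v i = f v := by
    rw [LinearMap.pi_apply_eq_sum_univ f v]
    refine Finset.sum_congr rfl fun i _ => ?_
    rw [smul_eq_mul, mul_comm]
    congr 2
    ext k
    simp [Pi.single_apply, eq_comm]
  refine ⟨fun i => f (Pi.single i 1), w j₀ - f (p j₀), fun j => ?_⟩
  rw [hsum]
  by_cases hj : j = j₀
  · rw [hj]; ring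
  · have h := hf ⟨j, hj⟩
    rw [vsub_eq_sub, map_sub] at h
    linarith

/-- Monomials are compatible with convex combinations of exponents. -/
theorem prod_rpow_prod_pow {ι κ : Type*} [Fintype ι] [Fintype κ] {α : ι → κ → ℕ} {y : κ → ℕ}
    {lam : ι → ℝ} (hlam : ∀ j, 0 ≤ lam j) (hy : ∀ i, (y i : ℝ) = ∑ j, lam j * (α j i : ℝ))
    {t : κ → ℝ} (ht : ∀ i, 0 ≤ t i) :
    ∏ j, (∏ i, t i ^ α j i) ^ lam j = ∏ i, t i ^ y i := by
  simp_rw [← Real.finsetProd_rpow _ _ (fun i _ => pow_nonneg (ht i) _)]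
  rw [Finset.prod_comm]
  refine Finset.prod_congr rfl fun i _ => ?_
  rw [← Real.rpow_natCast, hy i, Real.rpow_sum_of_nonneg (ht i)
    fun j _ => mul_nonneg (hlam j) (Nat.cast_nonneg _)]
  refine Finset.prod_congr rfl fun j _ => ?_
  rw [← Real.rpow_natCast, ← Real.rpow_mul (ht i), mul_comm]

/-- The weighted AM-GM inequality for the positive part of a circuit polynomial. -/
theorem circuitNumber_mul_abs_prod_pow_le {ι κ : Type*} [Fintype ι] [Fintype κ]
    {α : ι → κ → ℕ} (hα : ∀ j i, Even (α j i)) {b lam : ι → ℝ} (hb : ∀ j, 0 < b j)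
    (hlam : ∀ j, 0 < lam j) (hsum : ∑ j, lam j = 1) {y : κ → ℕ}
    (hy : ∀ i, (y i : ℝ) = ∑ j, lam j * (α j i : ℝ)) (x : κ → ℝ) :
    (∏ j, (b j / lam j) ^ lam j) * |∏ i, x i ^ y i| ≤ ∑ j, b j * ∏ i, x i ^ α j i := by
  have habs (j : ι) : ∏ i, |x i| ^ α j i = ∏ i, x i ^ α j i :=
    Finset.prod_congr rfl fun i _ => (hα j i).pow_abs _
  have hnn (j : ι) : 0 ≤ ∏ i, x i ^ α j i := Finset.prod_nonneg fun i _ => (hα j i).pow_nonneg _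
  have hq (j : ι) : 0 ≤ b j / lam j := (div_pos (hb j) (hlam j)).le
  have h := Real.geom_mean_le_arith_mean_weighted Finset.univ lam
    (fun j => b j / lam j * ∏ i, x i ^ α j i) (fun j _ => (hlam j).le) hsum
    (fun j _ => mul_nonneg (hq j) (hnn j))
  simp_rw [fun j => Real.mul_rpow (z := lam j) (hq j) (hnn j)] at h
  rw [Finset.prod_mul_distrib] at h
  simp_rw [← habs] at h
  rw [prod_rpow_prod_pow (fun j => (hlam j).le) hy fun i => abs_nonneg (x i)] at h
  simp_rw [← abs_pow] at h
  rw [← Finset.abs_prod] at h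
  refine h.trans (Finset.sum_le_sum fun j _ => le_of_eq ?_)
  simp_rw [abs_pow, habs]
  have := (hlam j).ne'
  field_simp

/-- The AM-GM inequality for a circuit is attained at a point with positive coordinates. -/
theorem exists_pos_sum_eq_circuitNumber_mul {ι κ : Type*} [Fintype ι] [Fintype κ] [Nonempty ι]
    {α : ι → κ → ℕ} (haff : AffineIndependent ℝ fun j i => (α j i : ℝ))
    {b lam : ι → ℝ} (hb : ∀ j, 0 < b j)
    (hlam : ∀ j, 0 < lam j) (hsum : ∑ j, lam j = 1) {y : κ → ℕ}
    (hy : ∀ i, (y i : ℝ) = ∑ j, lam j * (α j i : ℝ)) :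
    ∃ s : κ → ℝ, (∀ i, 0 < s i) ∧
      ∑ j, b j * ∏ i, s i ^ α j i = (∏ j, (b j / lam j) ^ lam j) * ∏ i, s i ^ y i := by
  obtain ⟨u, k, huk⟩ := haff.exists_sum_mul_add_eq (Classical.arbitrary ι)
    fun j => Real.log (lam j / b j)
  refine ⟨fun i => Real.exp (u i), fun i => Real.exp_pos _, ?_⟩
  have hmon (j : ι) : b j / lam j * ∏ i, Real.exp (u i) ^ α j i = Real.exp (-k) := by
    have h : ∏ i, Real.exp (u i) ^ α j i = lam j / b j * Real.exp (-k) := by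
      rw [← Real.exp_log (div_pos (hlam j) (hb j)), ← huk j, ← Real.exp_add, add_neg_cancel_right,
        Real.exp_sum]
      refine Finset.prod_congr rfl fun i _ => ?_
      rw [← Real.exp_nat_mul, mul_comm]
    have := (hb j).ne'
    have := (hlam j).ne'
    rw [h]
    field_simp
  have hpos (j : ι) : 0 ≤ ∏ i, Real.exp (u i) ^ α j i := by positivity
  rw [← prod_rpow_prod_pow (fun j => (hlam j).le) hy fun i => (Real.exp_pos (u i)).le,
    ← Finset.prod_mul_distrib]
  simp_rw [← fun j => Real.mul_rpow (z := lam j) (div_pos (hb j) (hlam j)).le (hpos j), hmon]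
  rw [← Real.rpow_sum_of_pos (Real.exp_pos _), hsum, Real.rpow_one]
  calc ∑ j, b j * ∏ i, Real.exp (u i) ^ α j i = ∑ j, lam j * Real.exp (-k) := by
        refine Finset.sum_congr rfl fun j _ => ?_
        rw [← hmon j]
        have := (hlam j).ne'
        field_simp
    _ = Real.exp (-k) := by rw [← Finset.sum_mul, hsum, one_mul]

/-- The effect on a monomial of changing the sign of one coordinate. -/
theorem prod_update_neg_pow {κ R : Type*} [Fintype κ] [DecidableEq κ] [CommRing R]
    (s : κ → R) (i : κ) (m : κ → ℕ) :
    ∏ k, Function.update s i (-s i) k ^ m k = (-1) ^ m i * ∏ k, s k ^ m k := by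
  rw [← Finset.mul_prod_erase _ _ (Finset.mem_univ i),
    ← Finset.mul_prod_erase _ (fun k => s k ^ m k) (Finset.mem_univ i), Function.update_self,
    neg_pow, mul_assoc]
  congr 2
  refine Finset.prod_congr rfl fun k hk => ?_
  rw [Function.update_of_ne (Finset.ne_of_mem_erase hk)]

/-- A circuit polynomial with `α(0) = 0` is nonnegative and has a real zero
(i.e. lies on the boundary of the nonnegativity cone, equivalently the A-discriminant
vanishes) iff `c = -Θ_f`, or `c = Θ_f` and `y ∉ (2ℕ)ⁿ`. -/
theorem circuit_poly_boundary_iff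
    (n : ℕ) (hn : 1 ≤ n)
    (α : Fin (n + 1) → Fin n → ℕ)
    (hαeven : ∀ j i, Even (α j i))
    (hα0 : ∀ i, α 0 i = 0)
    (haff : AffineIndependent ℝ (fun j : Fin (n + 1) => (fun i : Fin n => (α j i : ℝ))))
    (b : Fin (n + 1) → ℝ) (hb : ∀ j, 0 < b j)
    (c : ℝ) (hc : c ≠ 0)
    (y : Fin n → ℕ)
    (lam : Fin (n + 1) → ℝ) (hlam : ∀ j, 0 < lam j)
    (hlamsum : ∑ j, lam j = 1)
    (hy : ∀ i, (y i : ℝ) = ∑ j, lam j * (α j i : ℝ)) :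
    ((∀ x : Fin n → ℝ,
        0 ≤ ∑ j, b j * ∏ i, x i ^ α j i + c * ∏ i, x i ^ y i) ∧
      (∃ x : Fin n → ℝ,
        ∑ j, b j * ∏ i, x i ^ α j i + c * ∏ i, x i ^ y i = 0)) ↔
    (c = -(∏ j, (b j / lam j) ^ (lam j)) ∨
      (c = ∏ j, (b j / lam j) ^ (lam j) ∧ ¬ ∀ i, Even (y i))) := by
  have hamgm := circuitNumber_mul_abs_prod_pow_le hαeven hb hlam hlamsum hy
  obtain ⟨s, hs, hsy⟩ := exists_pos_sum_eq_circuitNumber_mul haff hb hlam hlamsum hy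
  have hΘ : 0 < ∏ j, (b j / lam j) ^ lam j :=
    Finset.prod_pos fun j _ => Real.rpow_pos_of_pos (div_pos (hb j) (hlam j)) _
  have hsmon : 0 < ∏ i, s i ^ y i := Finset.prod_pos fun i _ => pow_pos (hs i) _
  have hflip {i : Fin n} (hi : ¬ Even (y i)) :
      ∑ j, b j * ∏ k, Function.update s i (-s i) k ^ α j k
          + c * ∏ k, Function.update s i (-s i) k ^ y k
        = (∏ j, (b j / lam j) ^ lam j - c) * ∏ k, s k ^ y k := by
    simp_rw [prod_update_neg_pow, fun j => (hαeven j i).neg_one_pow (α := ℝ), one_mul, hsy,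
      (Nat.not_even_iff_odd.mp hi).neg_one_pow]
    ring
  set Θ := ∏ j, (b j / lam j) ^ lam j
  constructor
  · rintro ⟨hnonneg, x, hx⟩
    have hlower : -Θ ≤ c := by
      have h := hnonneg s
      rw [hsy, ← add_mul] at h
      linarith [nonneg_of_mul_nonneg_left h hsmon]
    have hxpos : 0 < ∑ j, b j * ∏ i, x i ^ α j i :=
      Finset.sum_pos' (fun j _ => mul_nonneg (hb j).le
        (Finset.prod_nonneg fun i _ => (hαeven j i).pow_nonneg _))
        ⟨0, Finset.mem_univ 0, by simpa [hα0] using hb 0⟩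
    have hxmon : ∏ i, x i ^ y i ≠ 0 := by
      intro h
      rw [h] at hx
      linarith
    have hcabs : Θ ≤ |c| := by
      refine le_of_mul_le_mul_right ?_ (abs_pos.mpr hxmon)
      rw [← abs_mul, ← abs_neg (c * _), ← eq_neg_of_add_eq_zero_left hx, abs_of_pos hxpos]
      exact hamgm x
    rcases le_abs'.mp hcabs with hle | hge
    · exact Or.inl (le_antisymm hle hlower)
    · have hodd : ¬ ∀ i, Even (y i) := by
        intro heven
        have := mul_nonneg (hΘ.le.trans hge)
          (Finset.prod_nonneg fun i (_ : i ∈ Finset.univ) => (heven i).pow_nonneg (x i))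
        linarith
      refine Or.inr ⟨le_antisymm ?_ hge, hodd⟩
      obtain ⟨i, hi⟩ := not_forall.mp hodd
      have h := hnonneg (Function.update s i (-s i))
      rw [hflip hi] at h
      linarith [nonneg_of_mul_nonneg_left h hsmon]
  · intro h
    have hcabs : |c| = Θ := by
      rcases h with h | ⟨h, -⟩
      · rw [h, abs_neg, abs_of_pos hΘ]
      · rw [h, abs_of_pos hΘ]
    refine ⟨fun x => ?_, ?_⟩
    · have h1 := hamgm x
      rw [← hcabs, ← abs_mul] at h1
      linarith [neg_abs_le (c * ∏ i, x i ^ y i)]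
    · rcases h with h | ⟨h, hodd⟩
      · exact ⟨s, by rw [hsy, h]; ring⟩
      · obtain ⟨i, hi⟩ := not_forall.mp hodd
        exact ⟨Function.update s i (-s i), by rw [hflip hi, h]; ring⟩
end

section
/- Let n ≥ 2, let b_1 ≥ b_2 ≥ … ≥ b_{n+1} > 0 be real numbers and λ_1,…,λ_n ∈ ℚ. Define g : ℝⁿ → ℂ by g(φ) = Σ_{j=1}^{n} b_j·e^{iφ_j} + b_{n+1}·e^{−i·Σ_{j=1}^{n} λ_j φ_j}. Then there exists a continuous path γ : [0,1] → ℝⁿ such that g(γ(t)) is real for all t ∈ [0,1], g(γ(0)) = Σ_{j=1}^{n+1} b_j, and g(γ(1)) ≤ b_1 + b_n + b_{n+1} − Σ_{j=2}^{n−1} b_j. -/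
open Set Filter

/-- The fibre product of two real functions, as a subset of the plane. -/
def fiberProduct (z h : ℝ → ℝ) : Set (ℝ × ℝ) := {p | z p.1 = h p.2}

theorem joinedIn_fiberProduct_of_section {z h br : ℝ → ℝ} (hh : Continuous h)
    (hbr : Continuous br) {a b : ℝ} (hz : ∀ x ∈ uIcc a b, z (br (h x)) = h x) :
    JoinedIn (fiberProduct z h) (br (h a), a) (br (h b), b) := by
  have hc : IsPathConnected ((fun x => (br (h x), x)) '' uIcc a b) :=
    ((convex_uIcc a b).isPathConnected nonempty_uIcc).image (by fun_prop)
  refine (hc.joinedIn _ ⟨a, left_mem_uIcc, rfl⟩ _ ⟨b, right_mem_uIcc, rfl⟩).mono ?_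
  rintro _ ⟨x, hx, rfl⟩
  exact hz x hx

/-- The first point of `[a, ∞)` where a continuous function attains a value. -/
theorem exists_first_eq {h : ℝ → ℝ} (hh : Continuous h) {a b c : ℝ} (hab : a ≤ b)
    (hb : h b = c) : ∃ x ∈ Icc a b, h x = c ∧ ∀ y ∈ Ico a x, h y ≠ c := by
  have hK : IsCompact (Icc a b ∩ h ⁻¹' {c}) :=
    isCompact_Icc.inter_right (isClosed_singleton.preimage hh)
  obtain ⟨x, ⟨hx, hxc⟩, hmin⟩ := hK.exists_isLeast ⟨b, ⟨hab, le_rfl⟩, hb⟩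
  refine ⟨x, hx, hxc, fun y hy hyc => ?_⟩
  have := hmin ⟨⟨hy.1, hy.2.le.trans hx.2⟩, hyc⟩
  exact absurd hy.2 (not_lt.mpr this)

/-- The last point of `(-∞, b]` where a continuous function attains a value. -/
theorem exists_last_eq {h : ℝ → ℝ} (hh : Continuous h) {a b c : ℝ} (hab : a ≤ b)
    (ha : h a = c) : ∃ x ∈ Icc a b, h x = c ∧ ∀ y ∈ Ioc x b, h y ≠ c := by
  have hK : IsCompact (Icc a b ∩ h ⁻¹' {c}) :=
    isCompact_Icc.inter_right (isClosed_singleton.preimage hh)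
  obtain ⟨x, ⟨hx, hxc⟩, hmax⟩ := hK.exists_isGreatest ⟨a, ⟨le_rfl, hab⟩, ha⟩
  refine ⟨x, hx, hxc, fun y hy hyc => ?_⟩
  have := hmax ⟨⟨hx.1.trans hy.1.le, hy.2⟩, hyc⟩
  exact absurd hy.1 (not_lt.mpr this)

theorem exists_eq_of_le_of_ge {h : ℝ → ℝ} (hh : Continuous h) {a b c : ℝ} (hab : a ≤ b)
    (hac : h a ≤ c ∧ c ≤ h b ∨ h b ≤ c ∧ c ≤ h a) : ∃ x ∈ Icc a b, h x = c := by
  rcases hac with hac | hac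
  · exact intermediate_value_Icc hab hh.continuousOn hac
  · exact intermediate_value_Icc' hab hh.continuousOn hac

/-- Between two consecutive turning levels, the fibre product over a zigzag with branches `up`,
`mid`, `low` moves from the upper to the lower branch. -/
theorem exists_joinedIn_low {z h up mid low : ℝ → ℝ} {m : ℝ} (hm : 0 < m) (hh : Continuous h)
    (hup : Continuous up) (hmid : Continuous mid) (hlow : Continuous low)
    (zup : ∀ y, -m ≤ y → z (up y) = y) (zmid : ∀ y, -m ≤ y → y ≤ m → z (mid y) = y)
    (zlow : ∀ y, y ≤ m → z (low y) = y) (hum : up (-m) = mid (-m)) (hlm : low m = mid m)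
    {a b : ℝ} (hab : a ≤ b) (ha : h a = m) (hb : h b = -m) :
    ∃ x, a < x ∧ h x = -m ∧ JoinedIn (fiberProduct z h) (up m, a) (low (-m), x) := by
  obtain ⟨x, hx, hxm, hfirst⟩ := exists_first_eq hh hab hb
  obtain ⟨w, hw, hwm, hlast⟩ := exists_last_eq hh hx.1 ha
  have hge : ∀ y ∈ Icc a x, -m ≤ h y := by
    intro y hy
    by_contra! hlt
    obtain ⟨v, hv, hvm⟩ := exists_eq_of_le_of_ge hh hy.1 (c := -m) (Or.inr ⟨hlt.le, by linarith⟩)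
    have hvy : v ≠ y := by rintro rfl; linarith
    exact hfirst v ⟨hv.1, (lt_of_le_of_ne hv.2 hvy).trans_le hy.2⟩ hvm
  have hle : ∀ y ∈ Icc w x, h y ≤ m := by
    intro y hy
    by_contra! hlt
    obtain ⟨v, hv, hvm⟩ := exists_eq_of_le_of_ge hh hy.2 (c := m) (Or.inr ⟨by linarith, hlt.le⟩)
    have hvy : v ≠ y := by rintro rfl; linarith
    exact hlast v ⟨hy.1.trans_lt (lt_of_le_of_ne hv.1 hvy.symm), hv.2⟩ hvm
  refine ⟨x, lt_of_le_of_ne hx.1 (by rintro rfl; linarith), hxm, ?_⟩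
  have h1 := joinedIn_fiberProduct_of_section (z := z) hh hup (a := a) (b := x) fun y hy => by
    rw [uIcc_of_le hx.1] at hy
    exact zup _ (hge y hy)
  have h2 := joinedIn_fiberProduct_of_section (z := z) hh hmid (a := x) (b := w) fun y hy => by
    rw [uIcc_of_ge hw.2] at hy
    exact zmid _ (hge y ⟨hw.1.trans hy.1, hy.2⟩) (hle y hy)
  have h3 := joinedIn_fiberProduct_of_section (z := z) hh hlow (a := w) (b := x) fun y hy => by
    rw [uIcc_of_le hw.2] at hy
    exact zlow _ (hle y hy)
  rw [ha, hxm] at h1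
  rw [hxm, hwm] at h2
  rw [hxm, hwm] at h3
  rw [hum] at h1
  rw [hlm] at h3
  exact (h1.trans h2).trans h3

/-- Symmetric mountain climbing over a single zigzag: if `z` has continuous branches of inverses
`up`, `mid` and `-up (-·)`, glued at the levels `±m`, and `h` is odd and tends to `∞`, then in the
fibre product of `z` and `h` one can get from the origin to arbitrarily high levels. -/
theorem exists_joinedIn_up {z h up mid : ℝ → ℝ} {m : ℝ} (hm : 0 ≤ m) (hh : Continuous h)
    (hodd : ∀ x, h (-x) = -h x) (htop : Tendsto h atTop atTop)
    (hup : Continuous up) (hmid : Continuous mid)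
    (zup : ∀ y, -m ≤ y → z (up y) = y) (zmid : ∀ y, -m ≤ y → y ≤ m → z (mid y) = y)
    (zlow : ∀ y, y ≤ m → z (-up (-y)) = y)
    (hum : up (-m) = mid (-m)) (hlm : -up (-m) = mid m) (hmid0 : mid 0 = 0) (Y : ℝ) :
    ∃ a, Y ≤ h a ∧ JoinedIn (fiberProduct z h) (0, 0) (up (h a), a) := by
  have h0 : h 0 = 0 := by have := hodd 0; simp at this; linarith
  have hbig : ∀ a Y : ℝ, ∃ b, a ≤ b ∧ Y ≤ h b := fun a Y =>
    ((eventually_ge_atTop a).and (htop.eventually_ge_atTop Y)).exists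
  set low : ℝ → ℝ := fun y => -up (-y) with hlowdef
  have hlow : Continuous low := by fun_prop
  rcases hm.eq_or_lt with rfl | hm
  · obtain ⟨a, ha0, ha⟩ := hbig 0 (max Y 0)
    refine ⟨a, (le_max_left _ _).trans ha, ?_⟩
    have hu0 : up 0 = 0 := by simpa [hmid0] using hum
    have key := joinedIn_fiberProduct_of_section (z := z) hh
      (br := fun y => if 0 ≤ y then up y else low y) (a := 0) (b := a)
      (Continuous.if_le hup hlow continuous_const continuous_id
        (by rintro y rfl; simp [hlowdef, hu0])) fun y _ => by
        split_ifs with hy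
        · exact zup _ (by simpa using hy)
        · exact zlow _ (not_le.mp hy).le
    simpa [h0, hu0, (le_max_right _ _).trans ha] using key
  by_contra! hcon
  set S : Set ℝ := {a | 0 ≤ a ∧
    (h a = m ∧ JoinedIn (fiberProduct z h) (0, 0) (up m, a) ∨
      h a = -m ∧ JoinedIn (fiberProduct z h) (0, 0) (low (-m), a))} with hS
  have hstep : ∀ a ∈ S, ∃ b ∈ S, a < b ∧ |h a - h b| = 2 * m := by
    rintro a ⟨ha0, ⟨ha, hj⟩ | ⟨ha, hj⟩⟩
    · have hex : ∃ b, a ≤ b ∧ h b = -m := by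
        by_contra! hno
        obtain ⟨b, hab, hb⟩ := hbig a Y
        have hge : ∀ y, a ≤ y → -m ≤ h y := by
          intro y hy
          by_contra! hlt
          obtain ⟨v, hv, hvm⟩ := exists_eq_of_le_of_ge hh hy (c := -m)
            (Or.inr ⟨hlt.le, by linarith⟩)
          exact hno v hv.1 hvm
        have := joinedIn_fiberProduct_of_section (z := z) hh hup (a := a) (b := b) fun y hy => by
          rw [uIcc_of_le hab] at hy
          exact zup _ (hge y hy.1)
        rw [ha] at this
        exact hcon b hb (hj.trans this)
      obtain ⟨b, hab, hb⟩ := hex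
      obtain ⟨x, hax, hx, hjx⟩ := exists_joinedIn_low hm hh hup hmid hlow zup zmid zlow hum
        hlm hab ha hb
      refine ⟨x, ⟨ha0.trans hax.le, Or.inr ⟨hx, hj.trans hjx⟩⟩, hax, ?_⟩
      rw [ha, hx, abs_of_nonneg] <;> linarith
    · obtain ⟨c, hac, hc⟩ := hbig a m
      obtain ⟨b, hab, hb⟩ := exists_eq_of_le_of_ge hh hac (c := m) (Or.inl ⟨by linarith, hc⟩)
      obtain ⟨x, hax, hx, hjx⟩ := exists_joinedIn_low (z := fun t => -z t) (h := fun t => -h t)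
        (up := fun y => low (-y)) (mid := fun y => mid (-y)) (low := fun y => up (-y)) hm
        (by fun_prop) (by fun_prop) (by fun_prop) (by fun_prop)
        (fun y hy => by rw [zlow _ (by linarith), neg_neg])
        (fun y hy hy' => by rw [zmid _ (by linarith) (by linarith), neg_neg])
        (fun y hy => by rw [zup _ (by linarith), neg_neg])
        (by simpa [hlowdef] using hlm) hum hab.1 (by linarith) (by linarith)
      have hfib : fiberProduct (fun t => -z t) (fun t => -h t) = fiberProduct z h := by
        ext p; simp [fiberProduct]
      rw [hfib, neg_neg] at hjx
      refine ⟨x, ⟨ha0.trans hax.le, Or.inl ⟨by linarith, hj.trans hjx⟩⟩, hax, ?_⟩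
      rw [ha, abs_of_nonpos] <;> linarith
  have hne : S.Nonempty := by
    obtain ⟨c, hc0, hc⟩ := hbig 0 m
    obtain ⟨b, hb0, hb⟩ := exists_eq_of_le_of_ge hh hc0 (c := m) (Or.inl ⟨by linarith, hc⟩)
    obtain ⟨x, hx, hxm, hfirst⟩ := exists_first_eq (h := fun x => |h x|) (by fun_prop) hb0.1
      (show |h b| = m by rw [hb, abs_of_pos hm])
    have hle : ∀ y ∈ Icc (-x) x, |h y| ≤ m := by
      have : ∀ y ∈ Icc 0 x, |h y| ≤ m := by
        intro y hy
        by_contra! hlt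
        obtain ⟨v, hv, hvm⟩ := exists_eq_of_le_of_ge (h := fun x => |h x|) (by fun_prop) hy.1
          (c := m) (Or.inl ⟨by simpa [h0] using hm.le, hlt.le⟩)
        have hvy : v ≠ y := by rintro rfl; linarith
        exact hfirst v ⟨hv.1, (lt_of_le_of_ne hv.2 hvy).trans_le hy.2⟩ hvm
      intro y hy
      rcases le_total 0 y with h' | h'
      · exact this y ⟨h', hy.2⟩
      · have := this (-y) ⟨by linarith, by linarith [hy.1]⟩
        rwa [hodd, abs_neg] at this
    have h1 := joinedIn_fiberProduct_of_section (z := z) hh hmid (a := 0) (b := -x) fun y hy => by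
      rw [uIcc_of_ge (by linarith [hx.1])] at hy
      have := abs_le.mp (hle y ⟨hy.1, hy.2.trans hx.1⟩)
      exact zmid _ this.1 this.2
    rw [h0, hmid0] at h1
    refine ⟨x, hx.1, ?_⟩
    rcases (abs_eq hm.le).mp hxm with hxm | hxm
    · have h2 := joinedIn_fiberProduct_of_section (z := z) hh hup (a := -x) (b := x) fun y hy => by
        rw [uIcc_of_le (by linarith [hx.1])] at hy
        exact zup _ (abs_le.mp (hle y hy)).1
      rw [hodd, hxm] at h1 h2
      rw [hum] at h2
      exact Or.inl ⟨hxm, h1.trans h2⟩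
    · have h2 := joinedIn_fiberProduct_of_section (z := z) hh hlow (a := -x) (b := x) fun y hy => by
        rw [uIcc_of_le (by linarith [hx.1])] at hy
        exact zlow _ (abs_le.mp (hle y hy)).2
      rw [hodd, hxm, neg_neg] at h1 h2
      have : low m = mid m := hlm
      rw [this] at h2
      exact Or.inr ⟨hxm, h1.trans h2⟩
  have hbdd : BddAbove S := by
    obtain ⟨T, hT⟩ := eventually_atTop.mp (htop.eventually_gt_atTop m)
    refine ⟨T, fun a ha => ?_⟩
    by_contra! hlt
    have := hT a hlt.le
    rcases ha.2 with ha | ha <;> linarith [ha.1]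
  obtain ⟨δ, hδ, hcont⟩ := Metric.continuousAt_iff.mp (hh.continuousAt (x := sSup S)) m hm
  obtain ⟨a, haS, ha⟩ := exists_lt_of_lt_csSup hne (show sSup S - δ < sSup S by linarith)
  obtain ⟨b, hbS, hab, habs⟩ := hstep a haS
  have hb := le_csSup hbdd hbS
  have h1 := hcont (x := a) (by rw [Real.dist_eq, abs_lt]; constructor <;> linarith)
  have h2 := hcont (x := b) (by rw [Real.dist_eq, abs_lt]; constructor <;> linarith)
  have := dist_triangle_right (h a) (h b) (h (sSup S))
  rw [Real.dist_eq (h a) (h b), habs] at this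
  linarith

/-- The extension of a function on `[a, b]` to the line by affine pieces of slope `1`. -/
def slopeOneExtend (f : ℝ → ℝ) (a b x : ℝ) : ℝ :=
  f (max a (min x b)) + (x - max a (min x b))

theorem slopeOneExtend_of_mem (f : ℝ → ℝ) {a b x : ℝ} (hx : x ∈ Icc a b) :
    slopeOneExtend f a b x = f x := by
  simp [slopeOneExtend, hx.1, hx.2]

/-- A strictly increasing continuous function on `[a, b]`, extended with slope `1`, has a
continuous strictly increasing inverse. -/
theorem exists_inverse_slopeOneExtend {f : ℝ → ℝ} {a b : ℝ} (hab : a ≤ b)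
    (hf : Continuous f) (hmono : StrictMonoOn f (Icc a b)) :
    ∃ u : ℝ → ℝ, Continuous u ∧ StrictMono u ∧ (∀ y, slopeOneExtend f a b (u y) = y) ∧
      ∀ x, u (slopeOneExtend f a b x) = x := by
  have hcont : Continuous (slopeOneExtend f a b) := by unfold slopeOneExtend; fun_prop
  have hmem : ∀ x, max a (min x b) ∈ Icc a b := fun x =>
    ⟨le_max_left _ _, max_le hab (min_le_right _ _)⟩
  have hF : StrictMono (slopeOneExtend f a b) := by
    intro x y hxy
    have h1 : max a (min x b) ≤ max a (min y b) := max_le_max le_rfl (min_le_min hxy.le le_rfl)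
    have h2 : y - max a (min y b) ≥ x - max a (min x b) := by grind
    rcases h1.eq_or_lt with h | h
    · simp only [slopeOneExtend, h]; linarith
    · have := hmono (hmem x) (hmem y) h
      simp only [slopeOneExtend]; linarith
  have hsurj : Function.Surjective (slopeOneExtend f a b) := by
    refine hcont.surjective ?_ ?_
    · refine tendsto_atTop_mono' atTop ?_
        (tendsto_atTop_add_const_left atTop (f b) (tendsto_atTop_add_const_right atTop (-b)
          tendsto_id))
      filter_upwards [eventually_ge_atTop b] with x hx
      simp [slopeOneExtend, hx, hab, sub_eq_add_neg]
    · refine tendsto_atBot_mono' atBot ?_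
        (tendsto_atBot_add_const_left atBot (f a) (tendsto_atBot_add_const_right atBot (-a)
          tendsto_id))
      filter_upwards [eventually_le_atBot a] with x hx
      simp [slopeOneExtend, hx, hx.trans hab, sub_eq_add_neg]
  let e := StrictMono.orderIsoOfSurjective _ hF hsurj
  exact ⟨e.symm, e.symm.continuous, e.symm.strictMono, e.apply_symm_apply, e.symm_apply_apply⟩

/-- There is a path in the fibre product of `θ` and `h` from the origin to a point whose first
coordinate has absolute value `T`. -/
def ReachesAbs (θ h : ℝ → ℝ) (T : ℝ) : Prop :=
  ∃ γ : ℝ → ℝ × ℝ, Continuous γ ∧ γ 0 = (0, 0) ∧ |(γ 1).1| = T ∧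
    ∀ s ∈ Icc (0 : ℝ) 1, θ (γ s).1 = h (γ s).2

theorem ReachesAbs.of_neg {θ h : ℝ → ℝ} {T : ℝ} (hodd : ∀ x, h (-x) = -h x)
    (H : ReachesAbs (fun t => -θ t) h T) : ReachesAbs θ h T := by
  obtain ⟨γ, hγ, h0, h1, hz⟩ := H
  refine ⟨fun s => ((γ s).1, -(γ s).2), by fun_prop, by simp [h0], h1, fun s hs => ?_⟩
  rw [hodd, ← hz s hs, neg_neg]

theorem ReachesAbs.of_joinedIn {θ z h : ℝ → ℝ} {T : ℝ} (hT : 0 ≤ T)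
    (hz : ∀ t, |t| ≤ T → z t = θ t) {p : ℝ × ℝ} (hp : T ≤ |p.1|)
    (H : JoinedIn (fiberProduct z h) (0, 0) p) : ReachesAbs θ h T := by
  set P := H.somePath
  have hP : ∀ s, P.extend s ∈ fiberProduct z h := fun s => by
    have : P.extend s ∈ range P := P.extend_range ▸ mem_range_self s
    obtain ⟨x, hx⟩ := this
    exact hx ▸ H.somePath_mem x
  have hc : Continuous fun s => |(P.extend s).1| := by fun_prop
  obtain ⟨b, hb, hbT⟩ := exists_eq_of_le_of_ge hc zero_le_one (c := T)
    (Or.inl ⟨by simpa using hT, by simpa using hp⟩)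
  obtain ⟨x, hx, hxT, hfirst⟩ := exists_first_eq hc hb.1 hbT
  refine ⟨fun s => P.extend (x * s), by fun_prop, by simp, by simpa using hxT, fun s hs => ?_⟩
  rw [← hz]
  · exact hP _
  by_contra! hlt
  obtain ⟨v, hv, hvT⟩ := exists_eq_of_le_of_ge hc (mul_nonneg hx.1 hs.1) (c := T)
    (Or.inl ⟨by simpa using hT, hlt.le⟩)
  have hvs : v ≠ x * s := by rintro rfl; exact hlt.ne' hvT
  exact hfirst v ⟨hv.1, (lt_of_le_of_ne hv.2 hvs).trans_le (mul_le_of_le_one_right hx.1 hs.2)⟩ hvT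

theorem reachesAbs_linear {h : ℝ → ℝ} (hh : Continuous h) (hodd : ∀ x, h (-x) = -h x)
    (htop : Tendsto h atTop atTop) (k : ℝ) {T : ℝ} (hT : 0 ≤ T) :
    ReachesAbs (fun t => k * t) h T := by
  have h0 : h 0 = 0 := by have := hodd 0; simp at this; linarith
  rcases eq_or_ne k 0 with rfl | hk
  · exact ⟨fun s => (T * s, 0), by fun_prop, by simp, by simpa using hT, by simp [h0]⟩
  obtain ⟨a, ha⟩ := (htop.eventually_ge_atTop (|k| * T)).exists
  have key := joinedIn_fiberProduct_of_section (z := fun t => k * t) hh (br := fun y => y / k)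
    (by fun_prop) (a := 0) (b := a) (fun x _ => by field_simp)
  simp only [h0, zero_div] at key
  refine ReachesAbs.of_joinedIn hT (fun _ _ => rfl) ?_ key
  rw [abs_div, le_div_iff₀ (abs_pos.mpr hk)]
  linarith [le_abs_self (h a)]

/-- A strictly convex function on a compact interval decreases strictly up to its minimum and
increases strictly after it. -/
theorem StrictConvexOn.exists_strictAntiOn_strictMonoOn {f : ℝ → ℝ} {a b : ℝ} (hab : a ≤ b)
    (hf : ContinuousOn f (Icc a b)) (hconv : StrictConvexOn ℝ (Icc a b) f) :
    ∃ x ∈ Icc a b, StrictAntiOn f (Icc a x) ∧ StrictMonoOn f (Icc x b) := by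
  obtain ⟨x, hx, hmin⟩ := isCompact_Icc.exists_isMinOn (nonempty_Icc.mpr hab) hf
  refine ⟨x, hx, fun u hu v hv huv => ?_, fun u hu v hv huv => ?_⟩
  · have huI : u ∈ Icc a b := ⟨hu.1, hu.2.trans hx.2⟩
    rcases hv.2.eq_or_lt with rfl | hvx
    · by_contra! hle
      have := hconv.lt_on_openSegment huI hx huv.ne
        (z := (u + v) / 2) (by rw [openSegment_eq_Ioo huv]; constructor <;> linarith)
      have h2 := hmin (show (u + v) / 2 ∈ Icc a b from
        ⟨by linarith [huI.1], by linarith [hx.2]⟩)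
      simp only [mem_ofPred_eq] at h2
      rw [max_eq_right hle] at this
      linarith
    · have := hconv.lt_on_openSegment huI hx (huv.trans hvx).ne
        (z := v) (by rw [openSegment_eq_Ioo (huv.trans hvx)]; exact ⟨huv, hvx⟩)
      have h2 : f x ≤ f u := hmin huI
      rwa [max_eq_left h2] at this
  · have hvI : v ∈ Icc a b := ⟨hx.1.trans hv.1, hv.2⟩
    rcases hu.1.eq_or_lt with rfl | hxu
    · by_contra! hle
      have := hconv.lt_on_openSegment hx hvI huv.ne
        (z := (x + v) / 2) (by rw [openSegment_eq_Ioo huv]; constructor <;> linarith)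
      have h2 := hmin (show (x + v) / 2 ∈ Icc a b from
        ⟨by linarith [hx.1], by linarith [hvI.2]⟩)
      simp only [mem_ofPred_eq] at h2
      rw [max_eq_left hle] at this
      linarith
    · have := hconv.lt_on_openSegment hx hvI (hxu.trans huv).ne
        (z := u) (by rw [openSegment_eq_Ioo (hxu.trans huv)]; exact ⟨hxu, huv⟩)
      have h2 : f x ≤ f v := hmin hvI
      rwa [max_eq_right h2] at this

theorem reachesAbs_of_strictConvexOn {f h : ℝ → ℝ} (hh : Continuous h)
    (hodd : ∀ x, h (-x) = -h x) (htop : Tendsto h atTop atTop) {T : ℝ} (hT : 0 ≤ T)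
    (hf : Continuous f) (hfodd : ∀ x, f (-x) = -f x) (hconv : StrictConvexOn ℝ (Icc 0 T) f) :
    ReachesAbs f h T := by
  have hf0 : f 0 = 0 := by have := hfodd 0; simp at this; linarith
  obtain ⟨r, hr, hanti, hmono⟩ := hconv.exists_strictAntiOn_strictMonoOn hT hf.continuousOn
  have hanti' : StrictMonoOn (fun x => -f x) (Icc (-r) r) := by
    have h1 : StrictMonoOn (fun x => -f x) (Icc 0 r) := fun x hx y hy hxy =>
      neg_lt_neg (hanti hx hy hxy)
    have h2 : StrictMonoOn (fun x => -f x) (Icc (-r) 0) := fun x hx y hy hxy => by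
      have := hanti (a := -y) (b := -x) ⟨by linarith [hy.2], by linarith [hy.1]⟩
        ⟨by linarith [hx.2], by linarith [hx.1]⟩ (by linarith)
      rw [hfodd, hfodd] at this
      exact this
    have := h2.union h1 (isGreatest_Icc (by linarith [hr.1])) (isLeast_Icc hr.1)
    rwa [Icc_union_Icc_eq_Icc (by linarith [hr.1]) hr.1] at this
  have hfr : f r ≤ 0 := by
    rcases hr.1.eq_or_lt with h | h
    · rw [← h, hf0]
    · rw [← hf0]; exact (hanti ⟨le_rfl, hr.1⟩ ⟨hr.1, le_rfl⟩ h).le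
  obtain ⟨u, hu, humono, hu1, hu2⟩ := exists_inverse_slopeOneExtend hr.2 hf hmono
  obtain ⟨v, hv, hvmono, hv1, hv2⟩ := exists_inverse_slopeOneExtend
    (show -r ≤ r by linarith [hr.1]) hf.neg hanti'
  have hur : u (f r) = r := by
    simpa [slopeOneExtend_of_mem f (left_mem_Icc.mpr hr.2)] using hu2 r
  have huT : u (f T) = T := by
    simpa [slopeOneExtend_of_mem f (right_mem_Icc.mpr hr.2)] using hu2 T
  have hvx : ∀ x ∈ Icc (-r) r, v (-f x) = x := fun x hx => by
    simpa [slopeOneExtend_of_mem _ hx] using hv2 x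
  have hvr : v (-f r) = r := hvx r ⟨by linarith [hr.1], le_rfl⟩
  have hvr' : v (f r) = -r := by
    have := hvx (-r) ⟨le_rfl, by linarith [hr.1]⟩
    rwa [hfodd, neg_neg] at this
  have hv0 : v 0 = 0 := by
    have := hvx 0 ⟨by linarith [hr.1], hr.1⟩
    rwa [hf0, neg_zero] at this
  set z := slopeOneExtend f (-T) T with hz
  have zodd : ∀ x, z (-x) = -z x := fun x => by
    have : max (-T) (min (-x) T) = -max (-T) (min x T) := by grind
    simp only [hz, slopeOneExtend, this, hfodd]
    ring
  have zup : ∀ y, f r ≤ y → z (u y) = y := fun y hy => by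
    have hle : r ≤ u y := hur ▸ humono.monotone hy
    have hcl : max (-T) (min (u y) T) = max r (min (u y) T) := by
      rw [max_eq_right (le_min hle hr.2), max_eq_right (le_min _ _)] <;> linarith [hr.1]
    rw [hz]
    conv_rhs => rw [← hu1 y]
    simp only [slopeOneExtend, hcl]
  have zmid : ∀ y, f r ≤ y → y ≤ -f r → z (v (-y)) = y := fun y hy hy' => by
    have hle : v (-y) ∈ Icc (-r) r := by
      constructor
      · rw [← hvr']; exact hvmono.monotone (by linarith)
      · rw [← hvr]; exact hvmono.monotone (by linarith)
    rw [hz, slopeOneExtend_of_mem _ ⟨by linarith [hle.1, hr.2], hle.2.trans hr.2⟩]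
    have := hv1 (-y)
    rw [slopeOneExtend_of_mem _ hle, Pi.neg_apply] at this
    linarith
  obtain ⟨a, ha, hj⟩ := exists_joinedIn_up (z := z) (mid := fun y => v (-y)) (m := -f r)
    (by linarith) hh hodd htop hu (by fun_prop) (fun y hy => zup y (by linarith))
    (fun y hy hy' => zmid y (by linarith) hy')
    (fun y hy => by rw [zodd, zup _ (by linarith), neg_neg])
    (by simp [hur, hvr]) (by simp [hur, hvr']) (by simp [hv0]) (f T)
  refine ReachesAbs.of_joinedIn hT (fun t ht => ?_) ?_ hj
  · exact slopeOneExtend_of_mem _ (abs_le.mp ht)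
  · exact (huT ▸ humono.monotone ha).trans (le_abs_self _)

theorem strictMono_div_sqrt_one_add_sq : StrictMono fun x : ℝ => x / √(1 + x ^ 2) := by
  intro x y hxy
  simp only [← Real.sin_arctan]
  exact Real.strictMonoOn_sin
    ⟨(Real.neg_pi_div_two_lt_arctan x).le, (Real.arctan_lt_pi_div_two x).le⟩
    ⟨(Real.neg_pi_div_two_lt_arctan y).le, (Real.arctan_lt_pi_div_two y).le⟩
    (Real.arctan_strictMono hxy)

theorem strictConcaveOn_arcsin_mul_sin {c : ℝ} (hc0 : 0 < c) (hc1 : c < 1) :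
    StrictConcaveOn ℝ (Icc 0 Real.pi) fun t => Real.arcsin (c * Real.sin t) := by
  have hlt : ∀ t, |c * Real.sin t| < 1 := fun t => by
    rw [abs_mul, abs_of_pos hc0]
    nlinarith [Real.abs_sin_le_one t, abs_nonneg (Real.sin t)]
  have hk : 0 < 1 - c ^ 2 := by nlinarith
  set k := √(1 - c ^ 2) with hkdef
  have hk0 : 0 < k := Real.sqrt_pos.mpr hk
  have hk2 : k ^ 2 = 1 - c ^ 2 := Real.sq_sqrt hk.le
  have hderiv : ∀ t, deriv (fun t => Real.arcsin (c * Real.sin t)) t =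
      (c / k * Real.cos t) / √(1 + (c / k * Real.cos t) ^ 2) := fun t => by
    have h := abs_lt.mp (hlt t)
    have hd := (Real.hasDerivAt_arcsin h.1.ne' h.2.ne).comp t ((Real.hasDerivAt_sin t).const_mul c)
    have hsq : 1 - (c * Real.sin t) ^ 2 = k ^ 2 * (1 + (c / k * Real.cos t) ^ 2) := by
      field_simp
      rw [hk2]
      linear_combination (-c ^ 2) * Real.sin_sq_add_cos_sq t
    have hpos : 0 < √(1 + (c / k * Real.cos t) ^ 2) := Real.sqrt_pos.mpr (by positivity)
    refine hd.deriv.trans ?_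
    rw [hsq, Real.sqrt_mul (sq_nonneg k), Real.sqrt_sq hk0.le]
    field_simp
  refine StrictAntiOn.strictConcaveOn_of_deriv (convex_Icc _ _) (by fun_prop) ?_
  rw [interior_Icc]
  intro x hx y hy hxy
  rw [hderiv, hderiv]
  refine strictMono_div_sqrt_one_add_sq (mul_lt_mul_of_pos_left ?_ (by positivity))
  exact Real.strictAntiOn_cos (Ioo_subset_Icc_self hx) (Ioo_subset_Icc_self hy) hxy

/-- A vector of length at most `1` rotating through half a turn has a continuous compensating
phase `p` for which the rotation can be followed in the fibre product with `h`. -/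
theorem exists_phase_reachesAbs {h : ℝ → ℝ} (hh : Continuous h) (hodd : ∀ x, h (-x) = -h x)
    (htop : Tendsto h atTop atTop) {c : ℝ} (hc0 : 0 ≤ c) (hc1 : c ≤ 1) (k l : ℝ) :
    ∃ p : ℝ → ℝ, Continuous p ∧ p 0 = 0 ∧ (∀ t, Real.sin (p t) = -(c * Real.sin t)) ∧
      ReachesAbs (fun t => k * t + l * p t) h Real.pi := by
  have hlin : ∀ d, ReachesAbs (fun t => k * t + l * (d * t)) h Real.pi := fun d => by
    have := reachesAbs_linear hh hodd htop (k + l * d) Real.pi_pos.le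
    simpa only [add_mul, mul_assoc] using this
  rcases hc0.eq_or_lt with rfl | hc0
  · exact ⟨fun t => 0 * t, by fun_prop, by simp, by simp, hlin 0⟩
  rcases hc1.eq_or_lt with rfl | hc1
  · exact ⟨fun t => -1 * t, by fun_prop, by simp, by simp, hlin (-1)⟩
  have hconc := strictConcaveOn_arcsin_mul_sin hc0 hc1
  have hsin : ∀ t, Real.sin (Real.arcsin (c * Real.sin t)) = c * Real.sin t := fun t => by
    have := Real.neg_one_le_sin t
    have := Real.sin_le_one t
    exact Real.sin_arcsin (by nlinarith) (by nlinarith)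
  have hconv : ∀ k l : ℝ, 0 < l → ReachesAbs
      (fun t => k * t + l * -Real.arcsin (c * Real.sin t)) h Real.pi := fun k l hl => by
    refine reachesAbs_of_strictConvexOn hh hodd htop Real.pi_pos.le (by fun_prop)
      (fun x => by simp only [Real.sin_neg, mul_neg, Real.arcsin_neg]; ring) ?_
    refine ConvexOn.add_strictConvexOn ?_ ?_
    · exact (LinearMap.mulLeft ℝ k).convexOn (convex_Icc _ _)
    · refine ⟨convex_Icc _ _, fun x hx y hy hxy a b ha hb hab => ?_⟩
      have := hconc.2 hx hy hxy ha hb hab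
      simp only [smul_eq_mul] at this ⊢
      nlinarith
  refine ⟨fun t => -Real.arcsin (c * Real.sin t), by fun_prop, by simp,
    fun t => by rw [Real.sin_neg, hsin], ?_⟩
  rcases lt_trichotomy l 0 with hl | rfl | hl
  · refine ReachesAbs.of_neg hodd ?_
    have := hconv (-k) (-l) (by linarith)
    convert this using 2
    ring
  · simpa using hlin 0
  · exact hconv k l hl

/-- Signs can be chosen so that a signed sum of numbers in `[0, B]` again lies in `[0, B]`. -/
theorem exists_signs_sum_mem_Icc {ι : Type*} [DecidableEq ι] (s : Finset ι) (b : ι → ℝ) {B : ℝ}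
    (hB : 0 ≤ B) (hb : ∀ i ∈ s, 0 ≤ b i ∧ b i ≤ B) :
    ∃ ε : ι → ℝ, (∀ i, ε i = 1 ∨ ε i = -1) ∧ ∑ i ∈ s, b i * ε i ∈ Icc 0 B := by
  induction s using Finset.induction_on with
  | empty => exact ⟨fun _ => 1, fun _ => Or.inl rfl, by simpa using hB⟩
  | insert a s ha ih =>
    obtain ⟨ε, hε, hS⟩ := ih fun i hi => hb i (Finset.mem_insert_of_mem hi)
    have hba := hb a (Finset.mem_insert_self a s)
    have hsum : ∀ σ τ : ℝ, ∑ i ∈ insert a s, b i * (if i = a then σ else τ * ε i) =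
        b a * σ + τ * ∑ i ∈ s, b i * ε i := fun σ τ => by
      rw [Finset.sum_insert ha, if_pos rfl, Finset.mul_sum]
      congr 1
      refine Finset.sum_congr rfl fun i hi => ?_
      rw [if_neg (ne_of_mem_of_not_mem hi ha)]
      ring
    rcases le_total (b a) (∑ i ∈ s, b i * ε i) with h | h
    · refine ⟨fun i => if i = a then -1 else 1 * ε i, fun i => ?_, ?_⟩
      · dsimp only; split_ifs <;> simp [hε]
      · rw [hsum]; constructor <;> linarith [hS.1, hS.2]
    · refine ⟨fun i => if i = a then 1 else -1 * ε i, fun i => ?_, ?_⟩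
      · dsimp only; split_ifs <;> rcases hε i with h | h <;> simp [h]
      · rw [hsum]; constructor <;> linarith [hS.1, hS.2]


/-- For `g(φ) = Σ_{j=1}^{n} b_j e^{iφ_j} + b_{n+1} e^{−iΣ_j λ_j φ_j}` with
`b_1 ≥ … ≥ b_{n+1} > 0` and `λ_j ∈ ℚ`, there is a continuous path `γ` on `[0,1]` along which
`g` is real, starting with value `Σ_{j=1}^{n+1} b_j` and ending with value at most
`b_1 + b_n + b_{n+1} − Σ_{j=2}^{n−1} b_j`.  (Here `b : Fin (n+1) → ℝ` with `b j` playing the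
role of `b_{j+1}` of the paper.) -/
theorem real_path_on_torus
    (n : ℕ) (hn : 2 ≤ n)
    (b : Fin (n + 1) → ℝ) (hb : ∀ j, 0 < b j)
    (hmono : ∀ j k : Fin (n + 1), j ≤ k → b k ≤ b j)
    (lam : Fin n → ℚ)
    (g : (Fin n → ℝ) → ℂ)
    (hg : ∀ φ : Fin n → ℝ, g φ =
        ∑ j : Fin n, (b j.castSucc : ℂ) * Complex.exp (Complex.I * (φ j : ℝ))
        + (b (Fin.last n) : ℂ) *
            Complex.exp (-Complex.I * ((∑ j : Fin n, (lam j : ℝ) * φ j : ℝ)))) :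
    ∃ γ : ℝ → (Fin n → ℝ),
      ContinuousOn γ (Set.Icc 0 1) ∧
      (∀ t ∈ Set.Icc (0 : ℝ) 1, (g (γ t)).im = 0) ∧
      g (γ 0) = ((∑ j : Fin (n + 1), b j : ℝ) : ℂ) ∧
      (g (γ 1)).re ≤ b 0 + b ⟨n - 1, by omega⟩ + b (Fin.last n)
        - ∑ j ∈ Finset.univ.filter
            (fun j : Fin (n + 1) => 1 ≤ (j : ℕ) ∧ (j : ℕ) < n - 1), b j := by
  have hg' : ∀ φ, g φ = ⟨∑ j : Fin n, b j.castSucc * Real.cos (φ j)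
        + b (Fin.last n) * Real.cos (∑ j : Fin n, (lam j : ℝ) * φ j),
      ∑ j : Fin n, b j.castSucc * Real.sin (φ j)
        - b (Fin.last n) * Real.sin (∑ j : Fin n, (lam j : ℝ) * φ j)⟩ := fun φ => by
    rw [hg]
    apply Complex.ext
    · simp [Complex.exp_re]
    · simp [Complex.exp_im, sub_eq_add_neg]
  obtain ⟨k, rfl⟩ : ∃ k, n = k + 2 := ⟨n - 2, by omega⟩
  set mid : Fin k → Fin (k + 3) := fun i => i.castSucc.succ.castSucc with hmid
  set v : Fin (k + 3) := (Fin.last (k + 1)).castSucc with hv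
  set w : Fin (k + 3) := Fin.last (k + 2) with hw
  obtain ⟨ε, hε, hS⟩ := exists_signs_sum_mem_Icc Finset.univ (fun i => b (mid i)) (hb 0).le
    fun i _ => ⟨(hb _).le, hmono _ _ (Fin.zero_le _)⟩
  set S := ∑ i, b (mid i) * ε i with hSdef
  set r := b w / b v with hr
  have hr0 : 0 < r := div_pos (hb w) (hb v)
  have hr1 : r ≤ 1 := (div_le_one (hb v)).mpr (hmono _ _ (Fin.le_last _))
  set a : ℝ → ℝ := fun ψ => Real.arcsin (r * Real.sin ψ) with ha
  have hsin : ∀ ψ, b v * Real.sin (a ψ) = b w * Real.sin ψ := fun ψ => by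
    have := Real.neg_one_le_sin ψ
    have := Real.sin_le_one ψ
    rw [ha, Real.sin_arcsin (by nlinarith) (by nlinarith), hr]
    field_simp [(hb v).ne']
  set μ : ℝ := (lam (Fin.last (k + 1)) : ℝ)
  have htop : Tendsto (fun ψ => ψ - μ * a ψ) atTop atTop := by
    refine tendsto_atTop_mono (fun ψ => ?_)
      (tendsto_atTop_add_const_right atTop (-(|μ| * (Real.pi / 2))) tendsto_id)
    have h1 : |a ψ| ≤ Real.pi / 2 :=
      abs_le.mpr ⟨Real.neg_pi_div_two_le_arcsin _, Real.arcsin_le_pi_div_two _⟩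
    have h2 := mul_le_mul_of_nonneg_left h1 (abs_nonneg μ)
    have h3 := le_abs_self (μ * a ψ)
    rw [abs_mul] at h3
    simp only [id]
    linarith
  obtain ⟨p, hp, hp0, hpsin, γ, hγ, hγ0, hγ1, hγz⟩ := exists_phase_reachesAbs
    (h := fun ψ => ψ - μ * a ψ) (by fun_prop)
    (fun x => by simp only [ha, Real.sin_neg, mul_neg, Real.arcsin_neg]; ring) htop
    (div_nonneg hS.1 (hb 0).le) ((div_le_one (hb 0)).mpr hS.2)
    (∑ i, (lam i.castSucc.succ : ℝ) * ε i) (lam 0)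
  have hpS : ∀ t, b 0 * Real.sin (p t) = -(S * Real.sin t) := fun t => by
    rw [hpsin]; field_simp [(hb 0).ne']
  let Φ : ℝ → Fin (k + 2) → ℝ := fun s =>
    Fin.cons (p (γ s).1) (Fin.snoc (α := fun _ => ℝ) (fun i => ε i * (γ s).1) (a (γ s).2))
  have hΦ : ∀ s (F : Fin (k + 2) → ℝ → ℝ), ∑ j, F j (Φ s j) =
      F 0 (p (γ s).1) + (∑ i : Fin k, F i.castSucc.succ (ε i * (γ s).1)
        + F (Fin.last (k + 1)) (a (γ s).2)) := fun s F => by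
    rw [Fin.sum_univ_succ, Fin.sum_univ_castSucc]
    simp [Φ]
  have hsum : ∀ s ∈ Icc (0 : ℝ) 1, ∑ j, (lam j : ℝ) * Φ s j = (γ s).2 := fun s hs => by
    have := hγz s hs
    simp only at this
    rw [hΦ s fun j x => (lam j : ℝ) * x]
    simp only [← mul_assoc, ← Finset.sum_mul]
    linarith
  have hsinε : ∀ i t, Real.sin (ε i * t) = ε i * Real.sin t := fun i t => by
    rcases hε i with h | h <;> simp [h]
  have hcosε : ∀ i t, Real.cos (ε i * t) = Real.cos t := fun i t => by
    rcases hε i with h | h <;> simp [h]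
  refine ⟨Φ, ?_, fun s hs => ?_, ?_, ?_⟩
  · refine Continuous.continuousOn (continuous_pi fun j => ?_)
    refine Fin.cases ?_ (fun j => ?_) j
    · simpa [Φ] using by fun_prop
    · refine Fin.lastCases ?_ (fun i => ?_) j
      · simpa [Φ] using by fun_prop
      · simpa [Φ] using by fun_prop
  · rw [hg']
    simp only
    rw [hsum s hs, hΦ s fun j x => b j.castSucc * Real.sin x]
    simp only [hsinε, ← mul_assoc, ← Finset.sum_mul, Fin.castSucc_zero]
    have h1 := hpS (γ s).1
    have h2 := hsin (γ s).2
    linarith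
  · have hΦ0 : Φ 0 = 0 := by
      ext j
      refine Fin.cases ?_ (fun j => ?_) j
      · simp [Φ, hγ0, hp0]
      · refine Fin.lastCases ?_ (fun i => ?_) j
        · simp [Φ, hγ0, ha]
        · simp [Φ, hγ0]
    rw [hΦ0, hg, Fin.sum_univ_castSucc b]
    simp [hw]
  · have hcosT : Real.cos (γ 1).1 = -1 := by rw [← Real.cos_abs, hγ1, Real.cos_pi]
    have hv' : (⟨k + 2 - 1, by omega⟩ : Fin (k + 2 + 1)) = v := by ext; simp [hv]
    have hfilter : ∑ j ∈ Finset.univ.filter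
        (fun j : Fin (k + 2 + 1) => 1 ≤ (j : ℕ) ∧ (j : ℕ) < k + 2 - 1), b j
        = ∑ i, b (mid i) := by
      rw [Finset.sum_filter, Fin.sum_univ_castSucc, Fin.sum_univ_succ, Fin.sum_univ_castSucc]
      simp [hmid]
    rw [hg', hv', hfilter]
    simp only
    rw [hΦ 1 fun j x => b j.castSucc * Real.cos x]
    simp only [hcosε, hcosT, Fin.castSucc_zero, ← Finset.sum_mul]
    have h1 := mul_le_mul_of_nonneg_left (Real.cos_le_one (p (γ 1).1)) (hb 0).le
    have h2 := mul_le_mul_of_nonneg_left (Real.cos_le_one (a (γ 1).2)) (hb v).le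
    have h3 := mul_le_mul_of_nonneg_left
      (Real.cos_le_one (∑ j, (lam j : ℝ) * Φ 1 j)) (hb w).le
    linarith
end

section
/- Let b_1, b_2 > 0 and b_3 ∈ ℝ \ {0} with b_1 ≥ b_2 ≥ |b_3|, and let λ_1, λ_2 ∈ ℚ. Define g : ℝ² → ℂ by g(φ_1, φ_2) = b_1·e^{iφ_1} + b_2·e^{iφ_2} + b_3·e^{−i(λ_1φ_1 + λ_2φ_2)}. Then for every real t ∈ [b_1, b_1 + b_2 + b_3] there exist φ_1, φ_2 ∈ ℝ with g(φ_1, φ_2) = t. -/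
/-- The angle between the sides of lengths `r` and `a` in a triangle with sides `r`, `a`, `b`. -/
noncomputable def triangleAngle (a b r : ℝ) : ℝ :=
  Real.arccos ((r ^ 2 + a ^ 2 - b ^ 2) / (2 * r * a))

lemma triangleAngle_add {a b : ℝ} (ha : 0 < a) (hb : 0 < b) :
    triangleAngle a b (a + b) = 0 := by
  have h : ((a + b) ^ 2 + a ^ 2 - b ^ 2) / (2 * (a + b) * a) = 1 := by
    rw [div_eq_one_iff_eq (by positivity)]
    ring
  rw [triangleAngle, h, Real.arccos_one]

lemma cos_triangleAngle {a b r : ℝ} (ha : 0 < a) (hr : 0 < r)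
    (h₁ : r ≤ a + b) (h₂ : a ≤ r + b) (h₃ : b ≤ r + a) :
    Real.cos (triangleAngle a b r) = (r ^ 2 + a ^ 2 - b ^ 2) / (2 * r * a) := by
  have hra : 0 < 2 * r * a := by positivity
  refine Real.cos_arccos ?_ ?_
  · rw [le_div_iff₀ hra]
    nlinarith [mul_nonneg (sub_nonneg.2 h₁) (sub_nonneg.2 h₂)]
  · rw [div_le_one hra]
    nlinarith [mul_nonneg (sub_nonneg.2 h₁) (sub_nonneg.2 h₂)]

lemma triangleAngle_law_of_sines {a b r : ℝ} (ha : 0 < a) (hb : 0 < b) (hr : 0 < r)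
    (h₁ : r ≤ a + b) (h₂ : a ≤ r + b) (h₃ : b ≤ r + a) :
    a * Real.sin (triangleAngle a b r) = b * Real.sin (triangleAngle b a r) := by
  have hA : 0 ≤ Real.sin (triangleAngle a b r) :=
    Real.sin_nonneg_of_nonneg_of_le_pi (Real.arccos_nonneg _) (Real.arccos_le_pi _)
  have hB : 0 ≤ Real.sin (triangleAngle b a r) :=
    Real.sin_nonneg_of_nonneg_of_le_pi (Real.arccos_nonneg _) (Real.arccos_le_pi _)
  refine (sq_eq_sq₀ (by positivity) (by positivity)).1 ?_
  rw [mul_pow, mul_pow, Real.sin_sq, Real.sin_sq, cos_triangleAngle ha hr h₁ h₂ h₃,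
    cos_triangleAngle hb hr (by linarith) h₃ h₂]
  field_simp
  ring

lemma triangleAngle_closing {a b r : ℝ} (ha : 0 < a) (hb : 0 < b) (hr : 0 < r)
    (h₁ : r ≤ a + b) (h₂ : a ≤ r + b) (h₃ : b ≤ r + a) :
    (a : ℂ) * Complex.exp (Complex.I * (triangleAngle a b r : ℝ))
      + b * Complex.exp (Complex.I * (-triangleAngle b a r : ℝ)) = r := by
  have hc : a * Real.cos (triangleAngle a b r) + b * Real.cos (triangleAngle b a r) = r := by
    rw [cos_triangleAngle ha hr h₁ h₂ h₃, cos_triangleAngle hb hr (by linarith) h₃ h₂]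
    field_simp
    ring
  have hs := triangleAngle_law_of_sines ha hb hr h₁ h₂ h₃
  rw [mul_comm Complex.I, mul_comm Complex.I, Complex.exp_mul_I, Complex.exp_mul_I,
    ← Complex.ofReal_cos, ← Complex.ofReal_sin, ← Complex.ofReal_cos, ← Complex.ofReal_sin,
    Real.cos_neg, Real.sin_neg]
  apply Complex.ext
  · simpa [-Complex.ofReal_cos, -Complex.ofReal_sin] using hc
  · simp [-Complex.ofReal_cos, -Complex.ofReal_sin, hs]

lemma triangleAngle_decomposition {a b : ℝ} {w : ℂ} (ha : 0 < a) (hb : 0 < b) (hw : 0 < ‖w‖)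
    (h₁ : ‖w‖ ≤ a + b) (h₂ : a ≤ ‖w‖ + b) (h₃ : b ≤ ‖w‖ + a) :
    (a : ℂ) * Complex.exp (Complex.I * (w.arg + triangleAngle a b ‖w‖ : ℝ))
      + b * Complex.exp (Complex.I * (w.arg - triangleAngle b a ‖w‖ : ℝ)) = w := by
  have h := triangleAngle_closing ha hb hw h₁ h₂ h₃
  conv_rhs => rw [← Complex.norm_mul_exp_arg_mul_I w, ← h]
  rw [sub_eq_add_neg, Complex.ofReal_add, Complex.ofReal_add, mul_add, mul_add, Complex.exp_add,
    Complex.exp_add, mul_comm (w.arg : ℂ)]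
  ring

lemma Continuous.triangleAngle {X : Type*} [TopologicalSpace X] {r : X → ℝ} (a b : ℝ)
    (ha : a ≠ 0) (hr : Continuous r) (h0 : ∀ x, r x ≠ 0) :
    Continuous fun x => triangleAngle a b (r x) := by
  unfold _root_.triangleAngle
  refine Real.continuous_arccos.comp (Continuous.div (by fun_prop) (by fun_prop) fun x => ?_)
  simpa [ha] using h0 x

/-- The vector from the tip of `c e^{is}` to `t`. -/
noncomputable def closingVector (t c s : ℝ) : ℂ :=
  t - c * Complex.exp (Complex.I * s)

lemma continuous_closingVector (t c : ℝ) : Continuous (closingVector t c) := by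
  unfold closingVector
  fun_prop

lemma closingVector_re (t c s : ℝ) : (closingVector t c s).re = t - c * Real.cos s := by
  simp [closingVector, mul_comm Complex.I, Complex.exp_ofReal_mul_I_re]

lemma closingVector_im (t c s : ℝ) : (closingVector t c s).im = -(c * Real.sin s) := by
  simp [closingVector, mul_comm Complex.I, Complex.exp_ofReal_mul_I_im]

lemma closingVector_add_two_pi (t c s : ℝ) :
    closingVector t c (s + 2 * Real.pi) = closingVector t c s := by
  apply Complex.ext <;> simp [closingVector_re, closingVector_im]

lemma closingVector_neg (t c s : ℝ) :
    closingVector t c (-s) = starRingEnd ℂ (closingVector t c s) := by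
  apply Complex.ext <;> simp [closingVector_re, closingVector_im]

lemma norm_closingVector_sq (t c s : ℝ) :
    ‖closingVector t c s‖ ^ 2 = t ^ 2 + c ^ 2 - 2 * t * c * Real.cos s := by
  rw [Complex.sq_norm, Complex.normSq_apply, closingVector_re, closingVector_im]
  linear_combination c ^ 2 * Real.sin_sq_add_cos_sq s

lemma sub_abs_le_closingVector_re (t c s : ℝ) : t - |c| ≤ (closingVector t c s).re := by
  rw [closingVector_re]
  have h : |c * Real.cos s| ≤ |c| := by
    rw [abs_mul]
    exact mul_le_of_le_one_right (abs_nonneg c) (Real.abs_cos_le_one s)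
  linarith [le_abs_self (c * Real.cos s)]

lemma norm_closingVector_le {t : ℝ} (ht : 0 ≤ t) (c s : ℝ) :
    ‖closingVector t c s‖ ≤ t + |c| := by
  refine (norm_sub_le _ _).trans (le_of_eq ?_)
  simp [mul_comm Complex.I, Complex.norm_exp_ofReal_mul_I, abs_of_nonneg ht]

/-- Along a branch of quadrilaterals with sides `a`, `b`, `c`, `t`, the combination
`l φ₁ + m φ₂ + φ₃` of the three directions, as a function of `s = φ₃`. -/
noncomputable def linkagePhase (a b c t l m s : ℝ) : ℝ :=
  l * ((closingVector t c s).arg + triangleAngle a b ‖closingVector t c s‖)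
    + m * ((closingVector t c s).arg - triangleAngle b a ‖closingVector t c s‖) + s

lemma linkagePhase_add_two_pi (a b c t l m s : ℝ) :
    linkagePhase a b c t l m (s + 2 * Real.pi) = linkagePhase a b c t l m s + 2 * Real.pi := by
  rw [linkagePhase, closingVector_add_two_pi, linkagePhase]
  ring

lemma continuous_linkagePhase {a b c t : ℝ} (l m : ℝ) (ha : a ≠ 0) (hb : b ≠ 0)
    (hct : |c| < t) : Continuous (linkagePhase a b c t l m) := by
  have hre (s : ℝ) : 0 < (closingVector t c s).re :=
    (sub_pos.2 hct).trans_le (sub_abs_le_closingVector_re t c s)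
  have hn (s : ℝ) : ‖closingVector t c s‖ ≠ 0 :=
    ((hre s).trans_le (Complex.re_le_norm _)).ne'
  have harg : Continuous fun s => (closingVector t c s).arg :=
    continuous_iff_continuousAt.2 fun s =>
      (Complex.continuousAt_arg (Or.inl (hre s))).comp (f := closingVector t c)
        (continuous_closingVector t c).continuousAt
  have hnorm : Continuous fun s => ‖closingVector t c s‖ := (continuous_closingVector t c).norm
  have hA := hnorm.triangleAngle a b ha hn
  have hB := hnorm.triangleAngle b a hb hn
  unfold linkagePhase
  fun_prop

lemma exists_linkagePhase_eq_of_add_abs_le {a b c t : ℝ} (l m : ℝ) (ha : 0 < a) (hb : 0 < b)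
    (hct : |c| < t) (h : t + |c| ≤ a + b) :
    ∃ s : ℝ, ‖closingVector t c s‖ ≤ a + b ∧
      ∃ k : ℤ, linkagePhase a b c t l m s = k * (2 * Real.pi) := by
  have hpi := Real.two_pi_pos
  set f := linkagePhase a b c t l m
  have hper : f (0 + 2 * Real.pi) = f 0 + 2 * Real.pi := linkagePhase_add_two_pi a b c t l m 0
  have hmem : (⌈f 0 / (2 * Real.pi)⌉ : ℝ) * (2 * Real.pi) ∈
      Set.Icc (f 0) (f (0 + 2 * Real.pi)) := by
    constructor
    · exact (div_le_iff₀ hpi).1 (Int.le_ceil _)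
    · rw [hper]
      calc _ ≤ (f 0 / (2 * Real.pi) + 1) * (2 * Real.pi) := by
            gcongr
            exact (Int.ceil_lt_add_one _).le
        _ = _ := by field_simp
  obtain ⟨s, -, hs⟩ := intermediate_value_Icc (by linarith)
    (continuous_linkagePhase l m ha.ne' hb.ne' hct).continuousOn hmem
  exact ⟨s, (norm_closingVector_le ((abs_nonneg c).trans hct.le) c s).trans h, _, hs⟩

lemma exists_linkagePhase_eq_zero_of_lt_add {a b c t : ℝ} (l m : ℝ) (ha : 0 < a) (hb : 0 < b)
    (hc : 0 < c) (hct : c < t) (h : a + b < t + c) (h' : t ≤ a + b + c) :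
    ∃ s : ℝ, ‖closingVector t c s‖ ≤ a + b ∧ linkagePhase a b c t l m s = 0 := by
  have ht := hc.trans hct
  have htc : 0 < 2 * t * c := by positivity
  set x := (t ^ 2 + c ^ 2 - (a + b) ^ 2) / (2 * t * c) with hx
  have hcos : Real.cos (Real.arccos x) = x := by
    refine Real.cos_arccos ?_ ?_
    · rw [hx, le_div_iff₀ htc]
      nlinarith
    · rw [hx, div_le_one htc]
      nlinarith
  have hxmul : 2 * t * c * x = t ^ 2 + c ^ 2 - (a + b) ^ 2 := by
    rw [hx]
    field_simp
  set θ := Real.arccos x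
  have hθ : 0 ≤ θ := Real.arccos_nonneg x
  have hθπ : θ ≤ Real.pi := Real.arccos_le_pi x
  have hnorm : ‖closingVector t c θ‖ = a + b := by
    refine (sq_eq_sq₀ (norm_nonneg _) (by positivity)).1 ?_
    rw [norm_closingVector_sq, hcos, hxmul]
    ring
  have hre : 0 < (closingVector t c θ).re :=
    (sub_pos.2 ((abs_of_pos hc).trans_lt hct)).trans_le (sub_abs_le_closingVector_re t c θ)
  have harg : (starRingEnd ℂ (closingVector t c θ)).arg = -(closingVector t c θ).arg := by
    rw [Complex.arg_conj, if_neg]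
    intro hπ
    linarith [(Complex.arg_eq_pi_iff.1 hπ).1]
  have hodd : linkagePhase a b c t l m (-θ) = -linkagePhase a b c t l m θ := by
    rw [linkagePhase, linkagePhase, closingVector_neg, harg, RCLike.norm_conj, hnorm,
      triangleAngle_add ha hb, add_comm a b, triangleAngle_add hb ha]
    ring
  have hmem : (0 : ℝ) ∈ Set.uIcc (linkagePhase a b c t l m (-θ))
      (linkagePhase a b c t l m θ) := by
    rw [hodd, Set.mem_uIcc]
    rcases le_total 0 (linkagePhase a b c t l m θ) with h0 | h0
    · left; constructor <;> linarith
    · right; constructor <;> linarith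
  obtain ⟨s, hs, hs0⟩ := intermediate_value_uIcc
    (continuous_linkagePhase l m ha.ne' hb.ne' ((abs_of_pos hc).trans_lt hct)).continuousOn hmem
  refine ⟨s, ?_, hs0⟩
  rw [Set.uIcc_of_le (by linarith)] at hs
  have hcs : x ≤ Real.cos s := by
    rw [← hcos, ← Real.cos_abs s]
    exact Real.cos_le_cos_of_nonneg_of_le_pi (abs_nonneg s) hθπ (abs_le.2 hs)
  refine (sq_le_sq₀ (norm_nonneg _) (by positivity)).1 ?_
  rw [norm_closingVector_sq]
  nlinarith [mul_le_mul_of_nonneg_left hcs htc.le]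

lemma exists_unit_sum_eq_one (l m : ℝ) :
    ∃ φ₁ φ₂ : ℝ, Complex.exp (Complex.I * φ₁) + Complex.exp (Complex.I * φ₂)
      + Complex.exp (-Complex.I * (l * φ₁ + m * φ₂ : ℝ)) = 1 := by
  have key (x y : ℝ) (h : y = x - Real.pi) :
      Complex.exp (Complex.I * x) + Complex.exp (Complex.I * y) = 0 := by
    rw [h, Complex.ofReal_sub, mul_sub, mul_comm _ (Real.pi : ℂ), Complex.exp_sub,
      Complex.exp_pi_mul_I]
    ring
  have hexp (x : ℝ) : Complex.exp (-Complex.I * x) = Complex.exp (Complex.I * (-x : ℝ)) := by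
    push_cast
    ring_nf
  by_cases hm : 1 + m = 0
  · by_cases hl : 1 + l = 0
    · refine ⟨Real.pi / 2, -(Real.pi / 2), ?_⟩
      rw [key _ _ (by ring), eq_neg_of_add_eq_zero_right hm, eq_neg_of_add_eq_zero_right hl]
      simp
    · refine ⟨Real.pi / (1 + l), 0, ?_⟩
      have := key (Real.pi / (1 + l)) (-(l * (Real.pi / (1 + l)) + m * 0)) (by field_simp; ring)
      rw [hexp, add_right_comm, this]
      simp
  · refine ⟨0, Real.pi / (1 + m), ?_⟩
    have := key (Real.pi / (1 + m)) (-(l * 0 + m * (Real.pi / (1 + m)))) (by field_simp; ring)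
    rw [hexp, add_assoc, this]
    simp

/-- For `g(φ₁,φ₂) = b₁ e^{iφ₁} + b₂ e^{iφ₂} + b₃ e^{−i(λ₁φ₁+λ₂φ₂)}` with
`b₁ ≥ b₂ ≥ |b₃|`, `b₁, b₂ > 0`, `b₃ ≠ 0` and `λ₁, λ₂ ∈ ℚ`, every real value in the
interval `[b₁, b₁ + b₂ + b₃]` is attained by `g`. -/
theorem hypotrochoid_real_values
    (b₁ b₂ b₃ : ℝ) (hb₁ : 0 < b₁) (hb₂ : 0 < b₂) (hb₃ : b₃ ≠ 0)
    (h12 : b₂ ≤ b₁) (h23 : |b₃| ≤ b₂)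
    (lam₁ lam₂ : ℚ)
    (g : ℝ → ℝ → ℂ)
    (hg : ∀ φ₁ φ₂ : ℝ, g φ₁ φ₂ =
        (b₁ : ℂ) * Complex.exp (Complex.I * (φ₁ : ℝ))
        + (b₂ : ℂ) * Complex.exp (Complex.I * (φ₂ : ℝ))
        + (b₃ : ℂ) * Complex.exp (-Complex.I * ((lam₁ : ℝ) * φ₁ + (lam₂ : ℝ) * φ₂ : ℝ))) :
    ∀ t ∈ Set.Icc b₁ (b₁ + b₂ + b₃),
      ∃ φ₁ φ₂ : ℝ, g φ₁ φ₂ = (t : ℂ) := by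
  rintro t ⟨ht₁, ht₂⟩
  simp only [hg]
  have hct : |b₃| ≤ t := h23.trans (h12.trans ht₁)
  rcases hct.eq_or_lt with heq | hlt
  · have h1 : b₁ = t := by linarith
    have h2 : b₂ = t := by linarith
    rcases le_or_gt 0 b₃ with h | h
    · have h3 : b₃ = t := by rw [← heq, abs_of_nonneg h]
      obtain ⟨φ₁, φ₂, hφ⟩ := exists_unit_sum_eq_one lam₁ lam₂
      refine ⟨φ₁, φ₂, ?_⟩
      rw [h1, h2, h3, ← mul_add, ← mul_add, hφ, mul_one]
    · have h3 : b₃ = -t := by rw [← heq, abs_of_neg h, neg_neg]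
      refine ⟨0, 0, ?_⟩
      simp [h1, h2, h3]
  · obtain ⟨s, hs, k, hk⟩ : ∃ s : ℝ, ‖closingVector t b₃ s‖ ≤ b₁ + b₂ ∧
        ∃ k : ℤ, linkagePhase b₁ b₂ b₃ t lam₁ lam₂ s = k * (2 * Real.pi) := by
      rcases le_or_gt (t + |b₃|) (b₁ + b₂) with h | h
      · exact exists_linkagePhase_eq_of_add_abs_le _ _ hb₁ hb₂ hlt h
      · have hpos : 0 < b₃ := by
          by_contra! hneg
          rw [abs_of_nonpos hneg] at h
          linarith
        rw [abs_of_pos hpos] at h hlt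
        obtain ⟨s, hs, hs0⟩ := exists_linkagePhase_eq_zero_of_lt_add
          lam₁ lam₂ hb₁ hb₂ hpos hlt h ht₂
        exact ⟨s, hs, 0, by simpa using hs0⟩
    have hn : t - |b₃| ≤ ‖closingVector t b₃ s‖ :=
      (sub_abs_le_closingVector_re t b₃ s).trans (Complex.re_le_norm _)
    have hdec := triangleAngle_decomposition hb₁ hb₂ ((sub_pos.2 hlt).trans_le hn) hs
      (by linarith) (by linarith [norm_nonneg (closingVector t b₃ s)])
    refine ⟨_, _, (congrArg₂ (· + ·) hdec ?_).trans (sub_add_cancel (t : ℂ) _)⟩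
    congr 1
    rw [Complex.exp_eq_exp_iff_exists_int]
    refine ⟨-k, ?_⟩
    rw [linkagePhase, ← eq_sub_iff_add_eq] at hk
    rw [hk]
    push_cast
    ring
end

section
/- Let f = Σ_{j=0}^{n} b_j·X^{α(j)} + c·X^{y} be a circuit polynomial (as a polynomial in ℝ[X_1,…,X_n]) and assume f is nonnegative on ℝⁿ. Then f is a sum of squares of polynomials if and only if (c > 0 and y ∈ (2ℕ)ⁿ) or there exists a Δ̂-mediated set L with y ∈ L. Moreover, if f is a sum of squares, then f is a sum of squares of binomials, i.e. of polynomials each having at most two monomials. -/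
open MvPolynomial

/-- The discrete Laplacian attached to a family of midpoints: the identity on `V`, and
`a q - (a (s q) + a (t q)) / 2` off `V`. -/
noncomputable def midpointLaplacian {ι E : Type*} [AddCommGroup E] [Module ℝ E]
    (V : Set ι) (s t : ι → ι) (a : ι → E) (q : ι) : E :=
  open Classical in if q ∈ V then a q else a q - (1 / 2 : ℝ) • (a (s q) + a (t q))

section Laplacian

variable {n : ℕ} {L : Finset (Fin n → ℤ)} {V : Set L} {s t : L → L}

/-- Minimum principle for the midpoint Laplacian. -/
theorem nonneg_of_midpointLaplacian_nonneg
    (hst : ∀ p : L, p ∉ V → s p ≠ t p ∧ ∀ i, 2 * p.1 i = (s p).1 i + (t p).1 i)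
    (v : L → ℝ) (hv : ∀ q, 0 ≤ midpointLaplacian V s t v q) (p : L) : 0 ≤ v p := by
  by_contra! hneg
  obtain ⟨p₀, -, hp₀⟩ := Finset.exists_min_image Finset.univ v ⟨p, Finset.mem_univ p⟩
  obtain ⟨p₁, hp₁, hmax⟩ := Finset.exists_max_image (Finset.univ.filter fun q => v q = v p₀)
    (fun q => ∑ i, q.1 i ^ 2) ⟨p₀, by simp⟩
  simp only [Finset.mem_filter, Finset.mem_univ, true_and] at hp₁ hmax
  have hlt : v p₁ < 0 := hp₁ ▸ (hp₀ p (Finset.mem_univ p)).trans_lt hneg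
  have hL := hv p₁
  by_cases hV : p₁ ∈ V
  · rw [midpointLaplacian, if_pos hV] at hL
    exact absurd hlt hL.not_gt
  rw [midpointLaplacian, if_neg hV, smul_eq_mul] at hL
  obtain ⟨hne, hmid⟩ := hst p₁ hV
  have hs := hp₀ (s p₁) (Finset.mem_univ _)
  have ht := hp₀ (t p₁) (Finset.mem_univ _)
  have hs' := hmax (s p₁) (by linarith)
  have ht' := hmax (t p₁) (by linarith)
  have key : 4 * ∑ i, p₁.1 i ^ 2 + ∑ i, ((s p₁).1 i - (t p₁).1 i) ^ 2
      = 2 * ∑ i, (s p₁).1 i ^ 2 + 2 * ∑ i, (t p₁).1 i ^ 2 := by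
    simp only [Finset.mul_sum, ← Finset.sum_add_distrib]
    refine Finset.sum_congr rfl fun i _ => ?_
    linear_combination (2 * p₁.1 i + (s p₁).1 i + (t p₁).1 i) * hmid i
  have hzero : ∑ i, ((s p₁).1 i - (t p₁).1 i) ^ 2 = 0 :=
    le_antisymm (by linarith) (Finset.sum_nonneg fun i _ => sq_nonneg _)
  rw [Finset.sum_eq_zero_iff_of_nonneg fun i _ => sq_nonneg _] at hzero
  refine hne (Subtype.ext (funext fun i => ?_))
  have := hzero i (Finset.mem_univ i)
  exact sub_eq_zero.mp (pow_eq_zero_iff two_ne_zero |>.mp this)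

/-- The midpoint Laplacian has a nonnegative inverse, valid for functions with values in any
real vector space. -/
theorem exists_nonneg_midpointLaplacian_inverse
    (hst : ∀ p : L, p ∉ V → s p ≠ t p ∧ ∀ i, 2 * p.1 i = (s p).1 i + (t p).1 i) :
    ∃ G : L → L → ℝ, (∀ p q, 0 ≤ G p q) ∧
      ∀ (E : Type) [AddCommGroup E] [Module ℝ E] (a : L → E) (p : L),
        a p = ∑ q, G p q • midpointLaplacian V s t a q := by
  classical
  let M : Matrix L L ℝ := fun q r =>
    midpointLaplacian V s t (fun x => if x = r then (1 : ℝ) else 0) q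
  have hM : ∀ (E : Type) [AddCommGroup E] [Module ℝ E] (a : L → E) (q : L),
      ∑ r, M q r • a r = midpointLaplacian V s t a q := by
    intro E _ _ a q
    by_cases hq : q ∈ V
    · simp [M, midpointLaplacian, hq, ite_smul]
    · simp [M, midpointLaplacian, hq, ite_smul, sub_smul, mul_add, add_smul,
        Finset.sum_sub_distrib, Finset.sum_add_distrib]
  have hMv : ∀ v : L → ℝ, M.mulVec v = midpointLaplacian V s t v := fun v => by
    ext q
    rw [← hM ℝ v q]
    simp [Matrix.mulVec, dotProduct]
  have hpos : ∀ v : L → ℝ, 0 ≤ M.mulVec v → 0 ≤ v := fun v hv p =>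
    nonneg_of_midpointLaplacian_nonneg hst v (fun q => by simpa [hMv] using hv q) p
  have hunit : IsUnit M := by
    rw [← Matrix.mulVec_injective_iff_isUnit]
    intro v w hvw
    apply le_antisymm
    · exact sub_nonneg.mp (hpos _ (by simp [Matrix.mulVec_sub, hvw]))
    · exact sub_nonneg.mp (hpos _ (by simp [Matrix.mulVec_sub, hvw]))
  have hdet : IsUnit M.det := (Matrix.isUnit_iff_isUnit_det M).mp hunit
  refine ⟨fun p q => (M⁻¹ : Matrix L L ℝ) p q, fun p q => ?_, fun E _ _ a p => ?_⟩
  · have := hpos (M⁻¹.mulVec (Pi.single q 1)) (by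
      rw [Matrix.mulVec_mulVec, Matrix.mul_nonsing_inv _ hdet, Matrix.one_mulVec]
      exact Pi.single_nonneg.mpr zero_le_one) p
    simpa using this
  · simp only [← hM, Finset.smul_sum, smul_smul]
    rw [Finset.sum_comm]
    have hone : ∀ r, ∑ q, (M⁻¹ : Matrix L L ℝ) p q * M q r = (1 : Matrix L L ℝ) p r := fun r => by
      rw [← Matrix.mul_apply, Matrix.nonsing_inv_mul _ hdet]
    simp only [← Finset.sum_smul, hone, Matrix.one_apply, ite_smul, one_smul, zero_smul]
    simp

/-- Expansion of the value at a point of a mediated set in terms of the values at the vertices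
and of the second differences at the other points. -/
theorem exists_vertex_expansion {κ : Type*} [Fintype κ] {vtx : κ → L}
    (hinj : Function.Injective vtx)
    (hst : ∀ p : L, p ∉ Set.range vtx → s p ≠ t p ∧ ∀ i, 2 * p.1 i = (s p).1 i + (t p).1 i)
    (p : L) :
    ∃ (w : κ → ℝ) (S : Finset L) (g : L → ℝ), (∀ j, 0 ≤ w j) ∧ (∀ q, 0 ≤ g q) ∧
      (∀ q ∈ S, q ∉ Set.range vtx) ∧
      ∀ (E : Type) [AddCommGroup E] [Module ℝ E] (a : L → E),
        a p = ∑ j, w j • a (vtx j) +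
          ∑ q ∈ S, g q • (a q - (1 / 2 : ℝ) • (a (s q) + a (t q))) := by
  classical
  obtain ⟨G, hG, hrep⟩ := exists_nonneg_midpointLaplacian_inverse hst
  refine ⟨fun j => G p (vtx j), Finset.univ.filter (· ∉ Set.range vtx), G p, fun _ => hG _ _, hG p,
    fun q hq => (Finset.mem_filter.mp hq).2, fun E _ _ a => ?_⟩
  rw [hrep E a p, ← Finset.sum_filter_add_sum_filter_not Finset.univ (· ∈ Set.range vtx)]
  congr 1
  · have himage : Finset.univ.filter (· ∈ Set.range vtx) = Finset.univ.image vtx := by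
      ext q
      simp
    rw [himage, Finset.sum_image hinj.injOn]
    exact Finset.sum_congr rfl fun j _ => by rw [midpointLaplacian, if_pos ⟨j, rfl⟩]
  · exact Finset.sum_congr rfl fun q hq => by
      rw [midpointLaplacian, if_neg (Finset.mem_filter.mp hq).2]

/-- The vertex weights of a vertex expansion are barycentric coordinates. -/
theorem barycentric_of_vertex_expansion {κ : Type*} [Fintype κ] {vtx : κ → L}
    (hst : ∀ p : L, p ∉ Set.range vtx → s p ≠ t p ∧ ∀ i, 2 * p.1 i = (s p).1 i + (t p).1 i)
    {p : L} {w : κ → ℝ} {S : Finset L} {g : L → ℝ} (hS : ∀ q ∈ S, q ∉ Set.range vtx)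
    (hrep : ∀ (E : Type) [AddCommGroup E] [Module ℝ E] (a : L → E),
      a p = ∑ j, w j • a (vtx j) +
        ∑ q ∈ S, g q • (a q - (1 / 2 : ℝ) • (a (s q) + a (t q)))) :
    ∑ j, w j = 1 ∧ ∀ i, (p.1 i : ℝ) = ∑ j, w j * ((vtx j).1 i : ℝ) := by
  constructor
  · have h := hrep ℝ fun _ => 1
    norm_num at h
    exact h.symm
  · intro i
    have h := hrep ℝ fun q => (q.1 i : ℝ)
    rw [h, Finset.sum_eq_zero (s := S), add_zero]
    · rfl
    · intro q hq
      have hmid : (2 * q.1 i : ℝ) = (s q).1 i + (t q).1 i := by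
        exact_mod_cast (hst q (hS q hq)).2 i
      rw [← hmid]
      simp

end Laplacian

/-- A finite set in which every point other than the `v j` is the midpoint of two distinct
points of the set lies in the convex hull of the `v j`. -/
theorem mem_convexHull_of_forall_midpoint {n : ℕ} {κ : Type*} [Fintype κ]
    {L : Finset (Fin n → ℤ)} {v : κ → Fin n → ℤ} (hinj : Function.Injective v)
    (hv : ∀ j, v j ∈ L)
    (hmed : ∀ p ∈ L, (∀ j, p ≠ v j) →
      ∃ s ∈ L, ∃ t ∈ L, s ≠ t ∧ ∀ i, 2 * p i = s i + t i)
    {p : Fin n → ℤ} (hp : p ∈ L) :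
    (fun i => (p i : ℝ)) ∈ convexHull ℝ (Set.range fun j i => (v j i : ℝ)) := by
  let vtx : κ → L := fun j => ⟨v j, hv j⟩
  have hmed' : ∀ p : L, ∃ s t : L, p ∉ Set.range vtx →
      s ≠ t ∧ ∀ i, 2 * p.1 i = s.1 i + t.1 i := by
    intro p
    by_cases hV : p ∈ Set.range vtx
    · exact ⟨p, p, fun h => absurd hV h⟩
    · obtain ⟨s, hs, t, ht, hne, hmid⟩ :=
        hmed p.1 p.2 fun j h => hV ⟨j, Subtype.ext h.symm⟩
      exact ⟨⟨s, hs⟩, ⟨t, ht⟩, fun _ => ⟨fun h => hne (congrArg Subtype.val h), hmid⟩⟩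
  choose s t hst using hmed'
  obtain ⟨w, S, g, hw, -, hS, hrep⟩ := exists_vertex_expansion
    (vtx := vtx) (fun i j h => hinj (congrArg Subtype.val h)) hst ⟨p, hp⟩
  obtain ⟨h₁, h₂⟩ := barycentric_of_vertex_expansion hst hS hrep
  have hp' : (fun i => (p i : ℝ)) = ∑ j, w j • fun i => (v j i : ℝ) := by
    ext i
    simpa [Finset.sum_apply] using h₂ i
  rw [hp']
  exact (convex_convexHull ℝ _).sum_mem (fun j _ => hw j) h₁ fun j _ =>
    subset_convexHull ℝ _ ⟨j, rfl⟩

/-- `f` is a finite sum of squares of polynomials with at most two monomials. -/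
def IsSumSqBinomials {n : ℕ} (f : MvPolynomial (Fin n) ℝ) : Prop :=
  ∃ (m : ℕ) (q : Fin m → MvPolynomial (Fin n) ℝ),
    (∀ i, (q i).support.card ≤ 2) ∧ f = ∑ i, q i ^ 2

namespace IsSumSqBinomials

variable {n : ℕ} {f g : MvPolynomial (Fin n) ℝ}

theorem zero : IsSumSqBinomials (0 : MvPolynomial (Fin n) ℝ) :=
  ⟨0, fun _ => 0, by simp, by simp⟩

theorem add (hf : IsSumSqBinomials f) (hg : IsSumSqBinomials g) : IsSumSqBinomials (f + g) := by
  obtain ⟨k, q, hq, rfl⟩ := hf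
  obtain ⟨l, r, hr, rfl⟩ := hg
  refine ⟨k + l, Fin.append q r, fun i => ?_, by simp [Fin.sum_univ_add]⟩
  induction i using Fin.addCases with
  | left i => simpa using hq i
  | right i => simpa using hr i

theorem sum {ι : Type*} (S : Finset ι) (F : ι → MvPolynomial (Fin n) ℝ)
    (hF : ∀ i ∈ S, IsSumSqBinomials (F i)) : IsSumSqBinomials (∑ i ∈ S, F i) :=
  Finset.sum_induction F IsSumSqBinomials (fun _ _ => add) zero hF

theorem smul_sq {r : ℝ} (hr : 0 ≤ r) (hf : f.support.card ≤ 2) :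
    IsSumSqBinomials (r • f ^ 2) := by
  refine ⟨1, fun _ => Real.sqrt r • f, fun _ => ?_, ?_⟩
  · exact (Finset.card_le_card support_smul).trans hf
  · simp [smul_pow, Real.sq_sqrt hr]

theorem smul {r : ℝ} (hr : 0 ≤ r) (hf : IsSumSqBinomials f) : IsSumSqBinomials (r • f) := by
  obtain ⟨m, q, hq, rfl⟩ := hf
  rw [Finset.smul_sum]
  exact sum _ _ fun i _ => smul_sq hr (hq i)

end IsSumSqBinomials

/-- If the monomial of exponent `p` appears in a sum of squares only through squares of
monomials, its coefficient is a sum of squares of coefficients, or zero when `p` is not even. -/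
theorem coeff_sum_sq_of_no_cross_term {σ : Type*} {m : ℕ} (q : Fin m → MvPolynomial σ ℝ)
    (p : σ →₀ ℕ)
    (hp : ∀ u v, (∃ k, u ∈ (q k).support) → (∃ k, v ∈ (q k).support) → u + v = p → u = v) :
    (∃ u, u + u = p ∧ coeff p (∑ k, q k ^ 2) = ∑ k, coeff u (q k) ^ 2) ∨
      ((∀ u, u + u ≠ p) ∧ coeff p (∑ k, q k ^ 2) = 0) := by
  classical
  have hoff : ∀ k, ∀ x ∈ Finset.HasAntidiagonal.antidiagonal p, x.1 ≠ x.2 →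
      coeff x.1 (q k) * coeff x.2 (q k) = 0 := by
    intro k x hx hne
    by_contra h
    obtain ⟨h₁, h₂⟩ := mul_ne_zero_iff.mp h
    exact hne (hp _ _ ⟨k, mem_support_iff.mpr h₁⟩ ⟨k, mem_support_iff.mpr h₂⟩
      (Finset.HasAntidiagonal.mem_antidiagonal.mp hx))
  by_cases hu : ∃ u, u + u = p
  · obtain ⟨u, hu⟩ := hu
    refine Or.inl ⟨u, hu, ?_⟩
    rw [coeff_sum]
    refine Finset.sum_congr rfl fun k _ => ?_
    rw [pow_two, coeff_mul, Finset.sum_eq_single (u, u), pow_two]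
    · intro x hx hne
      refine hoff k x hx fun h => hne ?_
      have h2 := Finset.HasAntidiagonal.mem_antidiagonal.mp hx
      rw [← h, ← hu] at h2
      have : x.1 = u := by
        ext i
        have := DFunLike.congr_fun h2 i
        simp only [Finsupp.add_apply] at this
        omega
      exact Prod.ext this (h ▸ this)
    · intro h
      exact absurd (Finset.HasAntidiagonal.mem_antidiagonal.mpr hu) h
  · refine Or.inr ⟨not_exists.mp hu, ?_⟩
    rw [coeff_sum]
    refine Finset.sum_eq_zero fun k _ => ?_
    rw [pow_two, coeff_mul]
    refine Finset.sum_eq_zero fun x hx => hoff k x hx fun h => hu ⟨x.1, ?_⟩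
    have h2 := Finset.HasAntidiagonal.mem_antidiagonal.mp hx
    rwa [← h] at h2

/-- An affinely independent family of points can be rescaled to attain arbitrary positive
values, up to a common factor. -/
theorem AffineIndependent.exists_prod_pow_eq {n : ℕ} {κ : Type*} [Fintype κ]
    {α : κ → Fin n → ℕ}
    (haff : AffineIndependent ℝ (fun j : κ => (fun i : Fin n => (α j i : ℝ))))
    (r : κ → ℝ) (hr : ∀ j, 0 < r j) :
    ∃ (k : ℝ) (x : Fin n → ℝ), 0 < k ∧ (∀ i, 0 < x i) ∧ ∀ j, ∏ i, x i ^ α j i = k * r j := by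
  have hli : LinearIndependent ℝ fun j : κ => ((1 : ℝ), fun i : Fin n => (α j i : ℝ)) := by
    rw [Fintype.linearIndependent_iff]
    intro g hg j
    refine affineIndependent_iff.mp haff Finset.univ g ?_ ?_ j (Finset.mem_univ j)
    · simpa [Prod.fst_sum] using congrArg Prod.fst hg
    · simpa [Prod.snd_sum] using congrArg Prod.snd hg
  obtain ⟨φ, hφ⟩ : ∃ φ : ℝ × (Fin n → ℝ) →ₗ[ℝ] ℝ,
      ∀ j, φ (1, fun i => (α j i : ℝ)) = Real.log (r j) := by
    obtain ⟨g, hg⟩ := LinearMap.exists_leftInverse_of_injective _ (LinearMap.ker_eq_bot.mpr hli)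
    refine ⟨Finsupp.linearCombination ℝ (fun j => Real.log (r j)) ∘ₗ g, fun j => ?_⟩
    have hj := LinearMap.congr_fun hg (Finsupp.single j 1)
    simp only [LinearMap.comp_apply, Finsupp.linearCombination_single, one_smul,
      LinearMap.id_apply] at hj
    simp [hj]
  refine ⟨Real.exp (-φ (1, 0)), fun i => Real.exp (φ (0, Pi.single i 1)), Real.exp_pos _,
    fun i => Real.exp_pos _, fun j => ?_⟩
  have hsplit : φ (1, fun i => (α j i : ℝ)) =
      φ (1, 0) + ∑ i, (α j i : ℝ) * φ (0, Pi.single i 1) := by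
    have hvec : ((1 : ℝ), fun i => (α j i : ℝ)) =
        (1, 0) + ∑ i, (α j i : ℝ) • ((0 : ℝ), (Pi.single i 1 : Fin n → ℝ)) := by
      ext i
      · simp [Prod.fst_sum]
      · simp [Prod.snd_sum, Finset.sum_apply, Pi.single_apply]
    rw [hvec, map_add, map_sum]
    simp only [map_smul, smul_eq_mul]
  rw [← Real.exp_log (hr j), ← hφ j, hsplit, ← Real.exp_add]
  simp only [← Real.exp_nat_mul, ← Real.exp_sum]
  congr 1
  ring

section ScaledMonomial

variable {n : ℕ}

/-- The monomial of exponent `p` in the rescaled variables `ν i * X i`. -/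
noncomputable def scaledMonomial (ν : Fin n → ℝ) (p : Fin n → ℕ) : MvPolynomial (Fin n) ℝ :=
  ∏ i, (C (ν i) * X i) ^ p i

theorem scaledMonomial_add (ν : Fin n → ℝ) (p q : Fin n → ℕ) :
    scaledMonomial ν (p + q) = scaledMonomial ν p * scaledMonomial ν q := by
  simp [scaledMonomial, pow_add, Finset.prod_mul_distrib]

theorem prod_X_pow_eq_monomial_equivFunOnFinite (p : Fin n → ℕ) :
    ∏ i, (X i : MvPolynomial (Fin n) ℝ) ^ p i =
      monomial (Finsupp.equivFunOnFinite.symm p) 1 := by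
  rw [monomial_eq, Finsupp.prod_fintype _ _ fun i => pow_zero _]
  simp

theorem card_support_scaledMonomial_le (ν : Fin n → ℝ) (p : Fin n → ℕ) :
    (scaledMonomial ν p).support.card ≤ 1 := by
  classical
  have h : scaledMonomial ν p =
      monomial (Finsupp.equivFunOnFinite.symm p) (∏ i, ν i ^ p i) := by
    simp only [scaledMonomial, mul_pow, Finset.prod_mul_distrib,
      prod_X_pow_eq_monomial_equivFunOnFinite, ← map_pow, ← map_prod, C_mul_monomial, mul_one]
  rw [h, support_monomial]
  split_ifs <;> simp

theorem card_support_scaledMonomial_sub_le (ν : Fin n → ℝ) (p q : Fin n → ℕ) :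
    (scaledMonomial ν p - scaledMonomial ν q).support.card ≤ 2 := by
  classical
  refine (Finset.card_le_card (support_sub _ _ _)).trans ((Finset.card_union_le _ _).trans ?_)
  have h₁ := card_support_scaledMonomial_le ν p
  have h₂ := card_support_scaledMonomial_le ν q
  omega

theorem prod_X_pow_eq_smul_scaledMonomial {μ : Fin n → ℝ} (hμ : ∀ i, μ i ≠ 0) (p : Fin n → ℕ) :
    ∏ i, (X i : MvPolynomial (Fin n) ℝ) ^ p i =
      (∏ i, μ i ^ p i) • scaledMonomial (fun i => (μ i)⁻¹) p := by
  rw [smul_eq_C_mul, scaledMonomial, map_prod, ← Finset.prod_mul_distrib]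
  refine Finset.prod_congr rfl fun i _ => ?_
  rw [map_pow, ← mul_pow, ← mul_assoc, ← C_mul, mul_inv_cancel₀ (hμ i), C_1, one_mul]

theorem isSumSqBinomials_smul_scaledMonomial {r : ℝ} (hr : 0 ≤ r) (ν : Fin n → ℝ)
    {p : Fin n → ℕ} (hp : ∀ i, Even (p i)) : IsSumSqBinomials (r • scaledMonomial ν p) := by
  have h : p = (fun i => p i / 2) + fun i => p i / 2 := by
    ext i
    have := hp i
    simp only [Pi.add_apply]
    grind
  rw [h, scaledMonomial_add, ← pow_two]
  exact IsSumSqBinomials.smul_sq hr ((card_support_scaledMonomial_le ν _).trans one_le_two)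

/-- The agiform attached to a point of a mediated set is a sum of squares of binomials. -/
theorem isSumSqBinomials_agiform {κ : Type*} [Fintype κ] {α : κ → Fin n → ℕ}
    (haff : AffineIndependent ℝ (fun j : κ => (fun i : Fin n => (α j i : ℝ))))
    {y : Fin n → ℕ} {lam : κ → ℝ} (hlamsum : ∑ j, lam j = 1)
    (hy : ∀ i, (y i : ℝ) = ∑ j, lam j * (α j i : ℝ))
    {L : Finset (Fin n → ℤ)} (hL : ∀ j, (fun i => (α j i : ℤ)) ∈ L)
    (hnonneg : ∀ p ∈ L, ∀ i, 0 ≤ p i)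
    (hmed : ∀ p ∈ L, (∀ j, p ≠ (fun i => (α j i : ℤ))) →
      ∃ s ∈ L, ∃ t ∈ L, s ≠ t ∧ (∀ i, Even (s i)) ∧ (∀ i, Even (t i)) ∧
        ∀ i, 2 * p i = s i + t i)
    (hyL : (fun i => (y i : ℤ)) ∈ L) (ν : Fin n → ℝ) :
    IsSumSqBinomials (∑ j, lam j • scaledMonomial ν (α j) - scaledMonomial ν y) := by
  let vtx : κ → L := fun j => ⟨fun i => (α j i : ℤ), hL j⟩
  have hinj : Function.Injective vtx := fun j k h => haff.injective <| by
    ext i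
    have hi : (α j i : ℤ) = α k i := congrFun (congrArg Subtype.val h) i
    exact_mod_cast hi
  have hmed' : ∀ p : L, ∃ s t : L, p ∉ Set.range vtx →
      (s ≠ t ∧ ∀ i, 2 * p.1 i = s.1 i + t.1 i) ∧ (∀ i, Even (s.1 i)) ∧ ∀ i, Even (t.1 i) := by
    intro p
    by_cases hV : p ∈ Set.range vtx
    · exact ⟨p, p, fun h => absurd hV h⟩
    · obtain ⟨s, hs, t, ht, hne, hse, hte, hmid⟩ :=
        hmed p.1 p.2 fun j h => hV ⟨j, Subtype.ext h.symm⟩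
      exact ⟨⟨s, hs⟩, ⟨t, ht⟩, fun _ =>
        ⟨⟨fun h => hne (congrArg Subtype.val h), hmid⟩, hse, hte⟩⟩
  choose s t hst using hmed'
  obtain ⟨w, S, g, -, hg, hS, hrep⟩ :=
    exists_vertex_expansion hinj (fun p hp => (hst p hp).1) ⟨_, hyL⟩
  obtain ⟨hw₁, hw₂⟩ := barycentric_of_vertex_expansion (fun p hp => (hst p hp).1) hS hrep
  have hw : lam = w := by
    ext j
    refine sub_eq_zero.mp (affineIndependent_iff.mp haff Finset.univ (fun j => lam j - w j)
      ?_ ?_ j (Finset.mem_univ j))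
    · simp [Finset.sum_sub_distrib, hlamsum, hw₁]
    · ext i
      have h := hw₂ i
      simp only [vtx, Int.cast_natCast] at h
      simp [Finset.sum_apply, sub_mul, Finset.sum_sub_distrib, ← hy, ← h]
  have hexp := hrep (MvPolynomial (Fin n) ℝ) fun q => scaledMonomial ν fun i => (q.1 i).toNat
  simp only [vtx, Int.toNat_natCast] at hexp
  rw [hw, hexp, sub_add_cancel_left, ← Finset.sum_neg_distrib]
  refine IsSumSqBinomials.sum S _ fun q hq => ?_
  obtain ⟨⟨-, hmid⟩, hse, hte⟩ := hst q (hS q hq)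
  set u : Fin n → ℕ := fun i => ((s q).1 i).toNat / 2 with hu
  set v : Fin n → ℕ := fun i => ((t q).1 i).toNat / 2 with hv
  have hs : (fun i => ((s q).1 i).toNat) = u + u := by
    ext i
    have := hse i
    have := hnonneg _ (s q).2 i
    simp only [hu, Pi.add_apply]
    grind
  have ht : (fun i => ((t q).1 i).toNat) = v + v := by
    ext i
    have := hte i
    have := hnonneg _ (t q).2 i
    simp only [hv, Pi.add_apply]
    grind
  have hquv : (fun i => (q.1 i).toNat) = u + v := by
    ext i
    have h₁ := congrFun hs i
    have h₂ := congrFun ht i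
    have h₃ := hmid i
    have h₄ := hnonneg _ q.2 i
    have h₅ := hnonneg _ (s q).2 i
    have h₆ := hnonneg _ (t q).2 i
    simp only [Pi.add_apply] at h₁ h₂ ⊢
    omega
  have hsq : -(g q • ((scaledMonomial ν fun i => (q.1 i).toNat) -
      (1 / 2 : ℝ) • ((scaledMonomial ν fun i => ((s q).1 i).toNat) +
        scaledMonomial ν fun i => ((t q).1 i).toNat))) =
      (g q / 2) • (scaledMonomial ν u - scaledMonomial ν v) ^ 2 := by
    rw [hs, ht, hquv, scaledMonomial_add, scaledMonomial_add, scaledMonomial_add]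
    have hpoly : (scaledMonomial ν u - scaledMonomial ν v) ^ 2 =
        scaledMonomial ν u * scaledMonomial ν u + scaledMonomial ν v * scaledMonomial ν v -
          (2 : ℝ) • (scaledMonomial ν u * scaledMonomial ν v) := by
      rw [ofNat_smul_eq_nsmul, nsmul_eq_mul]
      push_cast
      ring
    rw [hpoly]
    module
  rw [hsq]
  exact IsSumSqBinomials.smul_sq (div_nonneg (hg q) zero_le_two)
    (card_support_scaledMonomial_sub_le ν u v)

end ScaledMonomial

section Circuit

variable {n : ℕ} {κ : Type*} [Fintype κ] {α : κ → Fin n → ℕ} {b : κ → ℝ} {c : ℝ}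
  {y : Fin n → ℕ}

/-- Some sign pattern makes the inner term of a circuit polynomial negative, unless that term is
a monomial square. -/
theorem exists_sign_mul_prod_pow_neg (hc : c ≠ 0) (h : ¬(0 < c ∧ ∀ i, Even (y i))) :
    ∃ ε : Fin n → ℝ, (∀ i, ε i = 1 ∨ ε i = -1) ∧ c * ∏ i, ε i ^ y i < 0 := by
  classical
  rcases hc.lt_or_gt with hneg | hpos
  · exact ⟨fun _ => 1, fun _ => Or.inl rfl, by simpa using hneg⟩
  · obtain ⟨i₀, hi₀⟩ : ∃ i, ¬Even (y i) := by
      by_contra! hall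
      exact h ⟨hpos, hall⟩
    refine ⟨Pi.mulSingle i₀ (-1), fun i => ?_, ?_⟩
    · by_cases hi : i = i₀
      · subst hi
        simp
      · simp [hi]
    · rw [Finset.prod_eq_single i₀ (fun i _ hi => by simp [hi]) (by simp)]
      simpa [(Nat.not_even_iff_odd.mp hi₀).neg_one_pow] using hpos

/-- A circuit polynomial whose inner term is a monomial square is a sum of monomial squares. -/
theorem isSumSqBinomials_circuit_of_even (hαeven : ∀ j i, Even (α j i)) (hb : ∀ j, 0 < b j)
    (hc : 0 < c) (hy : ∀ i, Even (y i)) :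
    IsSumSqBinomials
      (∑ j, C (b j) * ∏ i, (X i : MvPolynomial (Fin n) ℝ) ^ α j i + C c * ∏ i, X i ^ y i) := by
  simp only [prod_X_pow_eq_smul_scaledMonomial (μ := fun _ => 1) (fun _ => one_ne_zero),
    one_pow, Finset.prod_const_one, one_smul, ← smul_eq_C_mul]
  exact (IsSumSqBinomials.sum _ _ fun j _ =>
    isSumSqBinomials_smul_scaledMonomial (hb j).le _ (hαeven j)).add
      (isSumSqBinomials_smul_scaledMonomial hc.le _ hy)

/-- A nonnegative circuit polynomial whose inner exponent lies in a mediated set is a sum of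
squares of binomials. -/
theorem isSumSqBinomials_circuit_of_mediated
    (hαeven : ∀ j i, Even (α j i))
    (haff : AffineIndependent ℝ (fun j : κ => (fun i : Fin n => (α j i : ℝ))))
    (hb : ∀ j, 0 < b j) (hc : c ≠ 0)
    {lam : κ → ℝ} (hlam : ∀ j, 0 < lam j) (hlamsum : ∑ j, lam j = 1)
    (hy : ∀ i, (y i : ℝ) = ∑ j, lam j * (α j i : ℝ))
    (hnonneg : ∀ x : Fin n → ℝ,
      0 ≤ eval x (∑ j, C (b j) * ∏ i, X i ^ α j i + C c * ∏ i, X i ^ y i))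
    {L : Finset (Fin n → ℤ)} (hL : ∀ j, (fun i => (α j i : ℤ)) ∈ L)
    (hLnonneg : ∀ p ∈ L, ∀ i, 0 ≤ p i)
    (hmed : ∀ p ∈ L, (∀ j, p ≠ (fun i => (α j i : ℤ))) →
      ∃ s ∈ L, ∃ t ∈ L, s ≠ t ∧ (∀ i, Even (s i)) ∧ (∀ i, Even (t i)) ∧
        ∀ i, 2 * p i = s i + t i)
    (hyL : (fun i => (y i : ℤ)) ∈ L) :
    IsSumSqBinomials
      (∑ j, C (b j) * ∏ i, (X i : MvPolynomial (Fin n) ℝ) ^ α j i + C c * ∏ i, X i ^ y i) := by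
  by_cases hsq : 0 < c ∧ ∀ i, Even (y i)
  · exact isSumSqBinomials_circuit_of_even hαeven hb hsq.1 hsq.2
  obtain ⟨ε, hε, hεneg⟩ := exists_sign_mul_prod_pow_neg hc hsq
  obtain ⟨k, x, hk, hx, hxα⟩ :=
    haff.exists_prod_pow_eq (fun j => lam j / b j) fun j => div_pos (hlam j) (hb j)
  set μ : Fin n → ℝ := fun i => ε i * x i with hμ
  have hμ0 : ∀ i, μ i ≠ 0 := fun i => by
    rcases hε i with h | h <;> simp [hμ, h, (hx i).ne']
  have hμα : ∀ j, b j * ∏ i, μ i ^ α j i = k * lam j := fun j => by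
    have hεα : ∀ i, ε i ^ α j i = 1 := fun i => by
      rcases hε i with h | h <;> simp [h, (hαeven j i).neg_one_pow]
    simp only [hμ, mul_pow, hεα, one_mul, hxα]
    field_simp [(hb j).ne']
  set d : ℝ := -(c * ∏ i, μ i ^ y i) with hd
  have hdpos : 0 < d := by
    simp only [hd, hμ, mul_pow, Finset.prod_mul_distrib, ← mul_assoc, neg_pos]
    exact mul_neg_of_neg_of_pos hεneg (Finset.prod_pos fun i _ => pow_pos (hx i) _)
  have hdk : d ≤ k := by
    have h := hnonneg μ
    simp only [map_add, map_sum, map_mul, map_prod, map_pow, eval_C, eval_X, hμα,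
      ← Finset.mul_sum, hlamsum] at h
    linarith
  set ν : Fin n → ℝ := fun i => (μ i)⁻¹
  have hf : ∑ j, C (b j) * ∏ i, (X i : MvPolynomial (Fin n) ℝ) ^ α j i + C c * ∏ i, X i ^ y i =
      ∑ j, ((k - d) * lam j) • scaledMonomial ν (α j) +
        d • (∑ j, lam j • scaledMonomial ν (α j) - scaledMonomial ν y) := by
    simp only [prod_X_pow_eq_smul_scaledMonomial hμ0, ← smul_eq_C_mul, smul_smul, hμα]
    rw [smul_sub, Finset.smul_sum, add_sub, ← Finset.sum_add_distrib, sub_eq_add_neg, ← neg_smul,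
      hd, neg_neg]
    congr 1
    exact Finset.sum_congr rfl fun j _ => by module
  rw [hf]
  refine (IsSumSqBinomials.sum _ _ fun j _ => isSumSqBinomials_smul_scaledMonomial
    (mul_nonneg (sub_nonneg.mpr hdk) (hlam j).le) _ (hαeven j)).add ?_
  exact IsSumSqBinomials.smul hdpos.le
    (isSumSqBinomials_agiform haff hlamsum hy hL hLnonneg hmed hyL ν)

/-- If a circuit polynomial is a sum of squares and its inner term is not a monomial square, then
its inner exponent lies in a mediated set. -/
theorem exists_mediated_of_circuit_eq_sum_sq
    (hinj : Function.Injective α) (hc : c ≠ 0)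
    (hsq : ¬(0 < c ∧ ∀ i, Even (y i))) {m : ℕ} {q : Fin m → MvPolynomial (Fin n) ℝ}
    (hq : ∑ j, C (b j) * ∏ i, X i ^ α j i + C c * ∏ i, X i ^ y i = ∑ k, q k ^ 2) :
    ∃ L : Finset (Fin n → ℤ),
      (∀ j, (fun i => (α j i : ℤ)) ∈ L) ∧
      (∀ p ∈ L, (fun i => (p i : ℝ)) ∈
        convexHull ℝ (Set.range (fun j : κ => fun i : Fin n => (α j i : ℝ)))) ∧
      (∀ p ∈ L, (∀ j, p ≠ (fun i => (α j i : ℤ))) →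
        ∃ s ∈ L, ∃ t ∈ L, s ≠ t ∧ (∀ i, Even (s i)) ∧ (∀ i, Even (t i)) ∧
          ∀ i, 2 * p i = s i + t i) ∧
      (fun i => (y i : ℤ)) ∈ L := by
  classical
  let A : Finset (Fin n →₀ ℕ) := Finset.univ.biUnion fun k => (q k).support
  have hA : ∀ u, u ∈ A ↔ ∃ k, u ∈ (q k).support := fun u => by simp [A]
  let L : Finset (Fin n → ℤ) := A.image (fun u i => 2 * (u i : ℤ)) ∪
    (Finset.univ.image (fun j i => (α j i : ℤ)) ∪ {fun i => (y i : ℤ)})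
  have hαL : ∀ j, (fun i => (α j i : ℤ)) ∈ L := fun j =>
    Finset.mem_union_right _ (Finset.mem_union_left _
      (Finset.mem_image_of_mem (fun j i => (α j i : ℤ)) (Finset.mem_univ j)))
  have hyL : (fun i => (y i : ℤ)) ∈ L :=
    Finset.mem_union_right _ (Finset.mem_union_right _ (Finset.mem_singleton_self _))
  have hAL : ∀ u ∈ A, (fun i => 2 * (u i : ℤ)) ∈ L := fun u hu =>
    Finset.mem_union_left _ (Finset.mem_image_of_mem (fun (u : Fin n →₀ ℕ) i => 2 * (u i : ℤ)) hu)
  have hcoeff : ∀ p : Fin n →₀ ℕ, (∀ j, ⇑p ≠ α j) →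
      coeff p (∑ k, q k ^ 2) = if ⇑p = y then c else 0 := by
    intro p hp
    have hne : ∀ z : Fin n → ℕ, Finsupp.equivFunOnFinite.symm z = p ↔ ⇑p = z := fun z =>
      ⟨fun h => h ▸ rfl, fun h => DFunLike.coe_injective h.symm⟩
    simp [← hq, prod_X_pow_eq_monomial_equivFunOnFinite, coeff_sum, coeff_C_mul,
      coeff_monomial, hne, hp]
  have hcross : ∀ p : Fin n →₀ ℕ, (∀ j, ⇑p ≠ α j) →
      (⇑p = y ∨ ∃ u ∈ A, u + u = p) → ∃ u ∈ A, ∃ v ∈ A, u ≠ v ∧ u + v = p := by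
    intro p hp hpy
    by_contra! hno
    have hdiag := coeff_sum_sq_of_no_cross_term q p fun u v hu hv huv => by
      by_contra huv'
      exact hno u ((hA u).mpr hu) v ((hA v).mpr hv) huv' huv
    rw [hcoeff p hp] at hdiag
    rcases hdiag with ⟨u, hu, hsum⟩ | ⟨hodd, hzero⟩
    · have hnn : (0 : ℝ) ≤ ∑ k, coeff u (q k) ^ 2 := Finset.sum_nonneg fun k _ => sq_nonneg _
      have hpy' : ⇑p ≠ y := by
        intro h
        rw [if_pos h] at hsum
        refine hsq ⟨lt_of_le_of_ne (hsum ▸ hnn) hc.symm, fun i => ⟨u i, ?_⟩⟩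
        rw [← h, ← hu, Finsupp.add_apply]
      obtain ⟨v, hvA, hv⟩ := hpy.resolve_left hpy'
      obtain ⟨k, hk⟩ := (hA v).mp hvA
      have huv : v = u := by
        ext i
        have := DFunLike.congr_fun (hv.trans hu.symm) i
        simp only [Finsupp.add_apply] at this
        omega
      rw [if_neg hpy', eq_comm, Finset.sum_eq_zero_iff_of_nonneg fun k _ => sq_nonneg _] at hsum
      rw [huv] at hk
      exact mem_support_iff.mp hk (pow_eq_zero_iff two_ne_zero |>.mp (hsum k (Finset.mem_univ k)))
    · rcases hpy with hpy | ⟨u, -, hu⟩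
      · exact hc (by rwa [if_pos hpy] at hzero)
      · exact hodd u hu
  have hmed : ∀ p ∈ L, (∀ j, p ≠ (fun i => (α j i : ℤ))) →
      ∃ s ∈ L, ∃ t ∈ L, s ≠ t ∧ (∀ i, Even (s i)) ∧ (∀ i, Even (t i)) ∧
        ∀ i, 2 * p i = s i + t i := by
    intro p hp hpv
    obtain ⟨P, rfl, hP⟩ : ∃ P : Fin n →₀ ℕ, p = (fun i => (P i : ℤ)) ∧
        (⇑P = y ∨ ∃ u ∈ A, u + u = P) := by
      rcases Finset.mem_union.mp hp with hp | hp
      · obtain ⟨u, hu, rfl⟩ := Finset.mem_image.mp hp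
        exact ⟨u + u, by ext i; simp [two_mul], Or.inr ⟨u, hu, rfl⟩⟩
      rcases Finset.mem_union.mp hp with hp | hp
      · obtain ⟨j, -, rfl⟩ := Finset.mem_image.mp hp
        exact absurd rfl (hpv j)
      · exact ⟨Finsupp.equivFunOnFinite.symm y, by simpa using hp, Or.inl (by simp)⟩
    obtain ⟨u, hu, v, hv, hne, rfl⟩ :=
      hcross P (fun j h => hpv j (funext fun i => by rw [h])) hP
    refine ⟨_, hAL u hu, _, hAL v hv, fun h => hne ?_, fun i => even_two_mul _,
      fun i => even_two_mul _, fun i => ?_⟩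
    · ext i
      have := congrFun h i
      omega
    · simp only [Finsupp.add_apply, Nat.cast_add]
      ring
  refine ⟨L, hαL, fun p hp => ?_, hmed, hyL⟩
  have hull := mem_convexHull_of_forall_midpoint (v := fun j i => (α j i : ℤ))
    (fun j k h => hinj (funext fun i => Int.natCast_inj.mp (congrFun h i))) hαL
    (fun p hp hpv => by
      obtain ⟨s, hs, t, ht, hne, -, -, hmid⟩ := hmed p hp hpv
      exact ⟨s, hs, t, ht, hne, hmid⟩) hp
  simpa using hull

end Circuit

/-- A nonnegative circuit polynomial `f = Σ_j b_j X^{α(j)} + c X^y` is a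
sum of squares iff `c > 0` and `y` is even, or `y` belongs to some `Δ̂`-mediated set `L`.
Moreover, if `f` is a sum of squares, it is a sum of squares of binomials. -/
theorem circuit_poly_sos_iff_mediated
    (n : ℕ) (hn : 1 ≤ n)
    (α : Fin (n + 1) → Fin n → ℕ)
    (hαeven : ∀ j i, Even (α j i))
    (haff : AffineIndependent ℝ (fun j : Fin (n + 1) => (fun i : Fin n => (α j i : ℝ))))
    (b : Fin (n + 1) → ℝ) (hb : ∀ j, 0 < b j)
    (c : ℝ) (hc : c ≠ 0)
    (y : Fin n → ℕ)
    (lam : Fin (n + 1) → ℝ) (hlam : ∀ j, 0 < lam j)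
    (hlamsum : ∑ j, lam j = 1)
    (hy : ∀ i, (y i : ℝ) = ∑ j, lam j * (α j i : ℝ))
    (f : MvPolynomial (Fin n) ℝ)
    (hf : f = ∑ j, C (b j) * ∏ i, X i ^ α j i + C c * ∏ i, X i ^ y i)
    (hnonneg : ∀ x : Fin n → ℝ, 0 ≤ eval x f) :
    ((∃ (m : ℕ) (q : Fin m → MvPolynomial (Fin n) ℝ), f = ∑ i, q i ^ 2) ↔
      ((0 < c ∧ ∀ i, Even (y i)) ∨
        ∃ L : Finset (Fin n → ℤ),
          -- `L` contains the vertex set `Δ̂`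
          (∀ j, (fun i => (α j i : ℤ)) ∈ L) ∧
          -- `L ⊆ Δ ∩ ℤⁿ`
          (∀ p ∈ L, (fun i => (p i : ℝ)) ∈
            convexHull ℝ (Set.range (fun j : Fin (n + 1) => fun i : Fin n => (α j i : ℝ)))) ∧
          -- every non-vertex point of `L` is a midpoint of two distinct even points of `L`
          (∀ p ∈ L, (∀ j, p ≠ (fun i => (α j i : ℤ))) →
            ∃ s ∈ L, ∃ t ∈ L, s ≠ t ∧ (∀ i, Even (s i)) ∧ (∀ i, Even (t i)) ∧
              ∀ i, 2 * p i = s i + t i) ∧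
          -- `y ∈ L`
          (fun i => (y i : ℤ)) ∈ L)) ∧
    ((∃ (m : ℕ) (q : Fin m → MvPolynomial (Fin n) ℝ), f = ∑ i, q i ^ 2) →
      ∃ (m : ℕ) (q : Fin m → MvPolynomial (Fin n) ℝ),
        (∀ i, (q i).support.card ≤ 2) ∧ f = ∑ i, q i ^ 2) := by
  have hinj : Function.Injective α := fun j k h => haff.injective (by simp only [h])
  have hcycle : ∀ {P Q R : Prop}, (P → Q) → (Q → R) → (R → P) → (P ↔ Q) ∧ (P → R) :=
    fun hPQ hQR hRP => ⟨⟨hPQ, hRP ∘ hQR⟩, hQR ∘ hPQ⟩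
  refine hcycle ?_ ?_ fun h => h.imp fun m ⟨q, _, hq⟩ => ⟨q, hq⟩
  · rintro ⟨m, q, hq⟩
    exact or_iff_not_imp_left.mpr fun hsq =>
      exists_mediated_of_circuit_eq_sum_sq hinj hc hsq (hf ▸ hq)
  · subst hf
    rintro (⟨hpos, heven⟩ | ⟨L, hL, hhull, hmed, hyL⟩)
    · exact isSumSqBinomials_circuit_of_even hαeven hb hpos heven
    · refine isSumSqBinomials_circuit_of_mediated hαeven haff hb hc hlam hlamsum hy hnonneg
        hL (fun p hp i => ?_) hmed hyL
      have hsub : convexHull ℝ (Set.range (fun j : Fin (n + 1) => fun i : Fin n => (α j i : ℝ)))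
          ⊆ Set.Ici 0 := by
        refine convexHull_min ?_ (convex_Ici 0)
        rintro _ ⟨j, rfl⟩ i
        exact Nat.cast_nonneg _
      have hpi : (0 : ℝ) ≤ p i := hsub (hhull p hp) i
      exact_mod_cast hpi
end

section
/- Let f = b_0 + Σ_{j=1}^{n} b_j·X^{α(j)} − Σ_{i=1}^{k} a_i·X^{y(i)} be as in the context, with the normalization b_0 = Σ_{i=1}^{k} λ_0^{(i)}. Then f is nonnegative on ℝⁿ if and only if there exist polynomials E_1,…,E_k, each nonnegative on ℝⁿ and each of the form E_i = c_{i,0} + Σ_{j=1}^{n} c_{i,j}·X^{α(j)} − a_i·X^{y(i)} with c_{i,0},…,c_{i,n} ≥ 0, such that f = Σ_{i=1}^{k} E_i. -/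
open MvPolynomial

open Filter Topology in
/-- A signomial whose negative part is supported in the interior of the standard simplex attains
its minimum over the nonnegative orthant at a point of the open orthant. -/
theorem exists_pos_isMin_signomial {ι κ : Type*} [Fintype ι] [Nonempty ι] [Fintype κ] [Nonempty κ]
    (b₀ : ℝ) {b : ι → ℝ} (hb : ∀ j, 0 < b j) {a : κ → ℝ} (ha : ∀ i, 0 < a i)
    {lam₀ : κ → ℝ} {lam : κ → ι → ℝ} (hlam₀ : ∀ i, 0 < lam₀ i) (hlam : ∀ i j, 0 < lam i j)
    (hsum : ∀ i, lam₀ i + ∑ j, lam i j = 1) :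
    ∃ v : ι → ℝ, (∀ j, 0 < v j) ∧ ∀ u : ι → ℝ, (∀ j, 0 ≤ u j) →
      b₀ + ∑ j, b j * v j - ∑ i, a i * ∏ j, v j ^ lam i j ≤
        b₀ + ∑ j, b j * u j - ∑ i, a i * ∏ j, u j ^ lam i j := by
  set G : (ι → ℝ) → ℝ := fun u => b₀ + ∑ j, b j * u j - ∑ i, a i * ∏ j, u j ^ lam i j with hG
  have hdecay : ∀ i, Tendsto (fun M : ℝ => M ^ (-lam₀ i)) atTop (𝓝 0) := fun i =>
    tendsto_rpow_neg_atTop (hlam₀ i)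
  have hsum' : ∀ i, ∑ j, lam i j = -lam₀ i + 1 := fun i => by linarith [hsum i]
  have hdiag : ∀ (i : κ) {t : ℝ}, 0 < t → ∏ j, t ^ lam i j = t ^ (-lam₀ i) * t := fun i t ht => by
    rw [← Real.rpow_sum_of_pos ht, hsum', Real.rpow_add ht, Real.rpow_one]
  obtain ⟨i₀⟩ := ‹Nonempty κ›
  obtain ⟨t, ht0, ht1, htG⟩ : ∃ t : ℝ, 0 < t ∧ t ≤ 1 ∧ G (fun _ => t) < b₀ := by
    have h1 : Tendsto (fun M : ℝ => M ^ (-lam₀ i₀) * ∑ j, b j) atTop (𝓝 0) := by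
      simpa using (hdecay i₀).mul_const (∑ j, b j)
    obtain ⟨M, hM, hM1⟩ := ((h1.eventually_lt_const (ha i₀)).and (eventually_ge_atTop 1)).exists
    have hM0 : 0 < M := by linarith
    refine ⟨M⁻¹, by positivity, inv_le_one_of_one_le₀ hM1, ?_⟩
    have h2 : a i₀ * ∏ j, M⁻¹ ^ lam i₀ j ≤ ∑ i, a i * ∏ j, M⁻¹ ^ lam i j :=
      Finset.single_le_sum (f := fun i => a i * ∏ j, M⁻¹ ^ lam i j)
        (fun i _ => mul_nonneg (ha i).le (Finset.prod_nonneg fun j _ => by positivity))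
        (Finset.mem_univ i₀)
    rw [hdiag i₀ (inv_pos.2 hM0), Real.inv_rpow hM0.le] at h2
    have hp : 0 < M ^ (-lam₀ i₀) := by positivity
    have h3 : (∑ j, b j) < (M ^ (-lam₀ i₀))⁻¹ * a i₀ := by
      rw [inv_mul_eq_div, lt_div_iff₀ hp]; linarith
    have h4 : (∑ j, b j) * M⁻¹ < (M ^ (-lam₀ i₀))⁻¹ * a i₀ * M⁻¹ :=
      mul_lt_mul_of_pos_right h3 (by positivity)
    simp only [hG, ← Finset.sum_mul]
    linarith
  obtain ⟨R, hR1, hR⟩ : ∃ R : ℝ, 1 ≤ R ∧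
      ∀ M, R ≤ M → ∀ j, ∑ i, a i * M ^ (-lam₀ i) < b j := by
    have h1 : Tendsto (fun M : ℝ => ∑ i, a i * M ^ (-lam₀ i)) atTop (𝓝 0) := by
      simpa using tendsto_finsetSum Finset.univ fun i _ => (hdecay i).const_mul (a i)
    obtain ⟨R, hR⟩ := eventually_atTop.1 (eventually_all.2 fun j => h1.eventually_lt_const (hb j))
    exact ⟨max 1 R, le_max_left _ _, fun M hM => hR M ((le_max_right _ _).trans hM)⟩
  have hout : ∀ u : ι → ℝ, (∀ j, 0 ≤ u j) → (∃ j, R < u j) → b₀ ≤ G u := by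
    rintro u hu ⟨j₁, hj₁⟩
    obtain ⟨j, hj⟩ := Finite.exists_max u
    have hRj : R ≤ u j := hj₁.le.trans (hj j₁)
    have hpos : 0 < u j := by linarith
    have h1 : ∑ i, a i * ∏ l, u l ^ lam i l ≤ (∑ i, a i * u j ^ (-lam₀ i)) * u j := by
      rw [Finset.sum_mul]
      refine Finset.sum_le_sum fun i _ => ?_
      rw [mul_assoc, ← hdiag i hpos]
      refine mul_le_mul_of_nonneg_left (Finset.prod_le_prod
        (fun l _ => Real.rpow_nonneg (hu l) _)
        fun l _ => Real.rpow_le_rpow (hu l) (hj l) (hlam i l).le) (ha i).le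
    have h2 : b j * u j ≤ ∑ l, b l * u l :=
      Finset.single_le_sum (f := fun l => b l * u l)
        (fun l _ => mul_nonneg (hb l).le (hu l)) (Finset.mem_univ j)
    have h3 := mul_le_mul_of_nonneg_right (hR _ hRj j).le hpos.le
    simp only [hG]
    linarith
  have hcont : Continuous G := by
    have : ∀ i j, Continuous fun u : ι → ℝ => u j ^ lam i j := fun i j =>
      (continuous_apply j).rpow_const fun _ => Or.inr (hlam i j).le
    fun_prop
  have htmem : (fun _ => t : ι → ℝ) ∈ Set.Icc (0 : ι → ℝ) (fun _ => R) :=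
    ⟨fun _ => ht0.le, fun _ => ht1.trans hR1⟩
  obtain ⟨v, hv, hmin⟩ := isCompact_Icc.exists_isMinOn ⟨_, htmem⟩ hcont.continuousOn
  have hvb : G v < b₀ := (hmin htmem).trans_lt htG
  refine ⟨v, fun j => (hv.1 j).lt_of_ne fun h => ?_, fun u hu => ?_⟩
  · have h0 : ∀ i, ∏ l, v l ^ lam i l = 0 := fun i =>
      Finset.prod_eq_zero (Finset.mem_univ j) (by
        rw [← h]; exact Real.zero_rpow (hlam i j).ne')
    have h1 : 0 ≤ ∑ l, b l * v l := Finset.sum_nonneg fun l _ => mul_nonneg (hb l).le (hv.1 l)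
    simp only [hG, h0, mul_zero, Finset.sum_const_zero] at hvb
    linarith
  · by_cases hRu : ∃ j, R < u j
    · exact hvb.le.trans (hout u hu hRu)
    · push Not at hRu
      exact hmin (show u ∈ Set.Icc _ _ from ⟨hu, hRu⟩)

/-- The first order condition at a positive minimizer of a signomial. -/
theorem signomial_critical_point {ι κ : Type*} [Fintype ι] [Fintype κ]
    {b₀ : ℝ} {b : ι → ℝ} {a : κ → ℝ} {lam : κ → ι → ℝ} {v : ι → ℝ} (hv : ∀ j, 0 < v j)
    (hmin : ∀ u : ι → ℝ, (∀ j, 0 ≤ u j) →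
      b₀ + ∑ j, b j * v j - ∑ i, a i * ∏ j, v j ^ lam i j ≤
        b₀ + ∑ j, b j * u j - ∑ i, a i * ∏ j, u j ^ lam i j) (j : ι) :
    b j * v j = ∑ i, a i * (∏ l, v l ^ lam i l) * lam i j := by
  classical
  set d : ι → ℝ := Pi.single j 1 with hd
  set P : κ → ℝ := fun i => ∏ l, v l ^ lam i l with hP
  set h : ℝ → ℝ := fun t => b₀ + ∑ l, b l * (v l * Real.exp (t * d l))
    - ∑ i, a i * (P i * Real.exp (t * ∑ l, lam i l * d l)) with hh
  have hexp : ∀ c : ℝ, HasDerivAt (fun t : ℝ => Real.exp (t * c)) c 0 := fun c => by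
    simpa using ((hasDerivAt_id (0 : ℝ)).mul_const c).exp
  have hder : HasDerivAt h (∑ l, b l * (v l * d l) - ∑ i, a i * (P i * ∑ l, lam i l * d l)) 0 :=
    ((HasDerivAt.fun_sum fun l _ => ((hexp (d l)).const_mul (v l)).const_mul (b l)).const_add
      b₀).sub (HasDerivAt.fun_sum fun i _ => ((hexp _).const_mul (P i)).const_mul (a i))
  have hloc : IsLocalMin h 0 := Filter.Eventually.of_forall fun t => by
    have h1 := hmin (fun l => v l * Real.exp (t * d l)) fun l => by have := hv l; positivity
    have h2 : ∀ i, ∏ l, (v l * Real.exp (t * d l)) ^ lam i l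
        = P i * Real.exp (t * ∑ l, lam i l * d l) := fun i => by
      rw [Finset.mul_sum, Real.exp_sum, ← Finset.prod_mul_distrib]
      refine Finset.prod_congr rfl fun l _ => ?_
      rw [Real.mul_rpow (hv l).le (Real.exp_pos _).le, ← Real.exp_mul]
      ring_nf
    simp only [h2] at h1
    simpa [hh] using h1
  have h0 := hloc.hasDerivAt_eq_zero hder
  simp only [hd, Pi.single_apply, mul_ite, mul_one, mul_zero, Finset.sum_ite_eq',
    Finset.mem_univ, if_true] at h0
  simp only [mul_assoc]
  linarith

/-- Weighted AM-GM with one of the variables equal to `1`, rescaled at a positive point `v`. -/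
theorem prod_rpow_le_rescaled_arith_mean {ι : Type*} [Fintype ι] {lam₀ : ℝ} {lam : ι → ℝ}
    (hlam₀ : 0 ≤ lam₀) (hlam : ∀ j, 0 ≤ lam j) (hsum : lam₀ + ∑ j, lam j = 1)
    {u v : ι → ℝ} (hu : ∀ j, 0 ≤ u j) (hv : ∀ j, 0 < v j) :
    ∏ j, u j ^ lam j ≤ (∏ j, v j ^ lam j) * (lam₀ + ∑ j, lam j * (u j / v j)) := by
  have h := Real.geom_mean_le_arith_mean_weighted (Finset.univ : Finset (Option ι))
    (fun o => o.elim lam₀ lam) (fun o => o.elim 1 fun j => u j / v j)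
    (by rintro (_ | j) _ <;> simp [hlam₀, hlam])
    (by simpa [Fintype.sum_option] using hsum)
    (by rintro (_ | j) _; exacts [zero_le_one, div_nonneg (hu j) (hv j).le])
  simp only [Fintype.sum_option, Fintype.prod_option, Option.elim, Real.one_rpow, one_mul,
    mul_one] at h
  refine le_trans (le_of_eq ?_) (mul_le_mul_of_nonneg_left h
    (Finset.prod_nonneg fun j _ => Real.rpow_nonneg (hv j).le _))
  rw [← Finset.prod_mul_distrib]
  refine Finset.prod_congr rfl fun j _ => ?_
  rw [← Real.mul_rpow (hv j).le (div_nonneg (hu j) (hv j).le), mul_div_cancel₀ _ (hv j).ne']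

/-- A monomial whose exponent is a nonnegative combination of even exponents is dominated by the
corresponding product of real powers. -/
theorem prod_pow_le_prod_rpow {ι σ : Type*} [Fintype ι] [Fintype σ] {α : ι → σ → ℕ}
    (hα : ∀ j l, Even (α j l)) {y : σ → ℕ} {lam : ι → ℝ} (hlam : ∀ j, 0 ≤ lam j)
    (hy : ∀ l, (y l : ℝ) = ∑ j, lam j * (α j l : ℝ)) (x : σ → ℝ) :
    ∏ l, x l ^ y l ≤ ∏ j, (∏ l, x l ^ α j l) ^ lam j := by
  have h1 : ∀ j, (∏ l, x l ^ α j l) ^ lam j = ∏ l, |x l| ^ (lam j * (α j l : ℝ)) := fun j => by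
    rw [← Real.finsetProd_rpow _ _ fun l _ => (hα j l).pow_nonneg _]
    refine Finset.prod_congr rfl fun l _ => ?_
    rw [mul_comm, Real.rpow_mul (abs_nonneg _), Real.rpow_natCast, (hα j l).pow_abs]
  calc ∏ l, x l ^ y l ≤ |∏ l, x l ^ y l| := le_abs_self _
    _ = ∏ l, |x l| ^ (y l : ℝ) := by simp [Finset.abs_prod, abs_pow]
    _ = ∏ l, ∏ j, |x l| ^ (lam j * (α j l : ℝ)) := by
      refine Finset.prod_congr rfl fun l _ => ?_
      rw [hy l, Real.rpow_sum_of_nonneg (abs_nonneg _)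
        fun j _ => mul_nonneg (hlam j) (Nat.cast_nonneg _)]
    _ = ∏ j, (∏ l, x l ^ α j l) ^ lam j := by
      rw [Finset.prod_comm]
      exact Finset.prod_congr rfl fun j _ => (h1 j).symm

/-- For linearly independent exponents, every positive vector is the vector of values of the
corresponding monomials at a positive point. -/
theorem exists_pos_prod_pow_eq {n : ℕ} {α : Fin n → Fin n → ℕ}
    (hlin : LinearIndependent ℝ (fun j : Fin n => (fun i : Fin n => (α j i : ℝ))))
    {v : Fin n → ℝ} (hv : ∀ j, 0 < v j) :
    ∃ x : Fin n → ℝ, (∀ l, 0 < x l) ∧ ∀ j, ∏ l, x l ^ α j l = v j := by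
  let A : Matrix (Fin n) (Fin n) ℝ := fun j i => (α j i : ℝ)
  have hA : IsUnit A := Matrix.linearIndependent_rows_iff_isUnit.1 hlin
  obtain ⟨t, ht⟩ := Matrix.mulVec_surjective_iff_isUnit.2 hA fun j => Real.log (v j)
  refine ⟨fun l => Real.exp (t l), fun l => Real.exp_pos _, fun j => ?_⟩
  rw [← Real.exp_log (hv j), ← congrFun ht j, Matrix.mulVec, dotProduct, Real.exp_sum]
  exact Finset.prod_congr rfl fun l _ => (Real.exp_nat_mul _ _).symm

/-- Let `f = b₀ + Σ_j b_j X^{α(j)} − Σ_i a_i X^{y(i)}` with simplex Newton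
polytope (vertices `0, α(1),…,α(n)` even), interior lattice exponents `y(i)`, and the
normalization `b₀ = Σ_i λ₀^{(i)}`. Then `f` is nonnegative iff it is a sum of nonnegative
circuit polynomials `E_i = c_{i,0} + Σ_j c_{i,j} X^{α(j)} − a_i X^{y(i)}`. -/
theorem simplex_poly_nonneg_iff_sonc
    (n k : ℕ) (hn : 1 ≤ n) (hk : 1 ≤ k)
    (α : Fin n → Fin n → ℕ)
    (hαeven : ∀ j i, Even (α j i))
    (hlin : LinearIndependent ℝ (fun j : Fin n => (fun i : Fin n => (α j i : ℝ))))
    (b₀ : ℝ) (hb₀ : 0 < b₀)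
    (b : Fin n → ℝ) (hb : ∀ j, 0 < b j)
    (a : Fin k → ℝ) (ha : ∀ i, 0 < a i)
    (y : Fin k → Fin n → ℕ) (hydist : Function.Injective y)
    (lam₀ : Fin k → ℝ) (lam : Fin k → Fin n → ℝ)
    (hlam₀ : ∀ i, 0 < lam₀ i) (hlam : ∀ i j, 0 < lam i j)
    (hlamsum : ∀ i, lam₀ i + ∑ j, lam i j = 1)
    (hy : ∀ i l, (y i l : ℝ) = ∑ j, lam i j * (α j l : ℝ))
    (hnorm : b₀ = ∑ i, lam₀ i)
    (f : MvPolynomial (Fin n) ℝ)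
    (hf : f = C b₀ + ∑ j, C (b j) * ∏ l, X l ^ α j l
        - ∑ i, C (a i) * ∏ l, X l ^ y i l) :
    (∀ x : Fin n → ℝ, 0 ≤ eval x f) ↔
      ∃ E : Fin k → MvPolynomial (Fin n) ℝ,
        (∀ i, ∃ (c₀ : ℝ) (cc : Fin n → ℝ), 0 ≤ c₀ ∧ (∀ j, 0 ≤ cc j) ∧
          E i = C c₀ + ∑ j, C (cc j) * ∏ l, X l ^ α j l
            - C (a i) * ∏ l, X l ^ y i l) ∧
        (∀ i, ∀ x : Fin n → ℝ, 0 ≤ eval x (E i)) ∧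
        f = ∑ i, E i := by
  constructor
  swap
  · rintro ⟨E, -, hE, rfl⟩ x
    rw [map_sum]
    exact Finset.sum_nonneg fun i _ => hE i x
  intro hnonneg
  have : Nonempty (Fin n) := ⟨⟨0, hn⟩⟩
  have : Nonempty (Fin k) := ⟨⟨0, hk⟩⟩
  obtain ⟨v, hv, hmin⟩ := exists_pos_isMin_signomial b₀ hb ha hlam₀ hlam hlamsum
  have hcrit := signomial_critical_point hv hmin
  set P : Fin k → ℝ := fun i => ∏ l, v l ^ lam i l with hP
  have hPpos : ∀ i, 0 < P i := fun i => Finset.prod_pos fun l _ => Real.rpow_pos_of_pos (hv l) _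
  set m : ℝ := b₀ - ∑ i, a i * P i * lam₀ i with hm
  have hm0 : 0 ≤ m := by
    obtain ⟨x, hx, hxv⟩ := exists_pos_prod_pow_eq hlin hv
    have hxy : ∀ i, ∏ l, x l ^ y i l = P i := fun i => by
      simp only [hP, ← hxv]
      have h1 : ∀ j, (∏ l, x l ^ α j l) ^ lam i j = ∏ l, x l ^ (lam i j * (α j l : ℝ)) :=
        fun j => by
          rw [← Real.finsetProd_rpow _ _ fun l _ => pow_nonneg (hx l).le _]
          refine Finset.prod_congr rfl fun l _ => ?_
          rw [mul_comm, Real.rpow_mul (hx l).le, Real.rpow_natCast]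
      simp only [h1]
      rw [Finset.prod_comm]
      refine Finset.prod_congr rfl fun l _ => ?_
      rw [← Real.rpow_sum_of_pos (hx l), ← hy, Real.rpow_natCast]
    have h := hnonneg x
    simp only [hf, map_sub, map_add, map_sum, map_mul, map_prod, map_pow, eval_C, eval_X,
      hxv, hxy, hcrit] at h
    rw [Finset.sum_comm] at h
    have h2 : ∑ i, a i * P i = ∑ i, a i * P i * lam₀ i + ∑ i, ∑ j, a i * P i * lam i j := by
      rw [← Finset.sum_add_distrib]
      refine Finset.sum_congr rfl fun i _ => ?_
      rw [← Finset.mul_sum, ← mul_add, hlamsum, mul_one]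
    linarith
  set c₀ : Fin k → ℝ := fun i => a i * P i * lam₀ i + m / k with hc₀
  set c : Fin k → Fin n → ℝ := fun i j => a i * P i * lam i j / v j with hc
  have hc₀sum : ∑ i, c₀ i = b₀ := by
    have hk0 : (k : ℝ) ≠ 0 := Nat.cast_ne_zero.2 (by lia)
    simp only [hc₀, Finset.sum_add_distrib, Finset.sum_const, Finset.card_univ, Fintype.card_fin,
      nsmul_eq_mul, mul_div_cancel₀ _ hk0, hm]
    ring
  have hcsum : ∀ j, ∑ i, c i j = b j := fun j => by
    simp only [hc]
    rw [← Finset.sum_div, ← hcrit, mul_div_cancel_right₀ _ (hv j).ne']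
  refine ⟨fun i => C (c₀ i) + ∑ j, C (c i j) * ∏ l, X l ^ α j l - C (a i) * ∏ l, X l ^ y i l,
    fun i => ⟨c₀ i, c i, ?_, fun j => ?_, rfl⟩, fun i x => ?_, ?_⟩
  · have := ha i; have := hPpos i; have := hlam₀ i
    positivity
  · have := ha i; have := hPpos i; have := hlam i j; have := hv j
    positivity
  · simp only [map_sub, map_add, map_sum, map_mul, map_prod, map_pow, eval_C, eval_X]
    have h1 := (prod_pow_le_prod_rpow hαeven (fun j => (hlam i j).le) (hy i) x).trans
      (prod_rpow_le_rescaled_arith_mean (hlam₀ i).le (fun j => (hlam i j).le) (hlamsum i)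
        (fun j => Finset.prod_nonneg fun l _ => (hαeven j l).pow_nonneg (x l)) hv)
    have h2 := mul_le_mul_of_nonneg_left h1 (ha i).le
    have h3 : a i * (P i * (lam₀ i + ∑ j, lam i j * ((∏ l, x l ^ α j l) / v j)))
        = a i * P i * lam₀ i + ∑ j, c i j * ∏ l, x l ^ α j l := by
      rw [← mul_assoc, mul_add, Finset.mul_sum]
      congr 1
      refine Finset.sum_congr rfl fun j _ => ?_
      simp only [hc]
      ring
    have h4 : 0 ≤ m / k := by positivity
    simp only [hc₀]
    linarith
  · rw [hf, Finset.sum_sub_distrib, Finset.sum_add_distrib, Finset.sum_comm, ← map_sum, hc₀sum]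
    simp only [← Finset.sum_mul, ← map_sum, hcsum]
end
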